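/- Let K = ℚ(√5) ⊂ ℝ, let A be the ring of integers of K, and let q be the quadratic form in 5 variables over K whose Gram matrix Q is the symmetric 5×5 matrix with all diagonal entries 1, entries Q_{01} = Q_{10} = Q_{34} = Q_{43} = −(1+√5)/4, entries Q_{12} = Q_{21} = Q_{23} = Q_{32} = −1/2, and all other entries 0. For n ≥ 5 and a positive integer a, define the quadratic form f_a in n+1 variables by f_a(x_0, x_1, ..., x_n) = q(x_0,...,x_4) + a·x_5^2 + x_6^2 + ... + x_n^2. Then the group O(f_a, A) of matrices M ∈ GL(n+1, A) preserving f_a is noncoherent: it contains a finitely generated subgroup that is not finitely presented. -/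

import Mathlib

namespace Paper

open Matrix

/-- Value at `x` of the quadratic form with Gram matrix `Q`. -/
def qeval {m : ℕ} {R : Type*} [CommRing R] (Q : Matrix (Fin m) (Fin m) R) (x : Fin m → R) : R :=
  x ⬝ᵥ (Q *ᵥ x)

/-- The polar bilinear form `B(x,y) = (f(x+y) - f(x) - f(y))/2` of the quadratic form
with Gram matrix `Q`. -/
def qpolar {m : ℕ} {K : Type*} [Field K] (Q : Matrix (Fin m) (Fin m) K) (x y : Fin m → K) : K :=
  (qeval Q (x + y) - qeval Q x - qeval Q y) / 2

/-- A real quadratic form (given by its Gram matrix `Q`) has signature `(r,s)`: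
`r + s = m` and it is linearly equivalent over `ℝ` to
`x_1^2 + ... + x_r^2 - x_{r+1}^2 - ... - x_m^2`. -/
def RealSignature {m : ℕ} (Q : Matrix (Fin m) (Fin m) ℝ) (r s : ℕ) : Prop :=
  r + s = m ∧ ∃ T : Matrix (Fin m) (Fin m) ℝ, T.det ≠ 0 ∧
    ∀ x : Fin m → ℝ, qeval Q (T *ᵥ x) = ∑ i : Fin m, (if (i : ℕ) < r then (x i)^2 else -(x i)^2)

/-- A rational quadratic form has signature `(r,s)` if it does as a real quadratic form. -/
def HasSignature {m : ℕ} (Q : Matrix (Fin m) (Fin m) ℚ) (r s : ℕ) : Prop :=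
  RealSignature (Q.map (Rat.cast : ℚ → ℝ)) r s

/-- The rational quadratic form `F` (in `n` variables) represents the rational quadratic
form `G` (in `k` variables): after a linear change of coordinates over `ℚ`,
`F(x_1,...,x_n) = G(x_1,...,x_k) + H(x_{k+1},...,x_n)` for some rational quadratic form `H`. -/
def Represents {n k : ℕ} (F : Matrix (Fin n) (Fin n) ℚ) (G : Matrix (Fin k) (Fin k) ℚ) : Prop :=
  ∃ (m : ℕ) (hm : n = k + m) (H : Matrix (Fin m) (Fin m) ℚ) (T : Matrix (Fin n) (Fin n) ℚ),
    T.det ≠ 0 ∧ ∀ (x : Fin k → ℚ) (y : Fin m → ℚ),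
      qeval F (T *ᵥ (Fin.append x y ∘ Fin.cast hm)) = qeval G x + qeval H y

/-- The group `O(f, A)` of matrices in `GL(m, A)` preserving the quadratic form `f`
(with Gram matrix `Q` over `K ⊇ A`): those `M` with `f(Mx) = f(x)` for all `x`. -/
def ortho {m : ℕ} (A : Type*) [CommRing A] {K : Type*} [Field K] [Algebra A K]
    (Q : Matrix (Fin m) (Fin m) K) : Subgroup (GL (Fin m) A) where
  carrier := { M | ∀ x : Fin m → K,
      qeval Q (((M : Matrix (Fin m) (Fin m) A).map (algebraMap A K)) *ᵥ x) = qeval Q x }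
  one_mem' := by
    intro x
    have h1 : ((1 : GL (Fin m) A) : Matrix (Fin m) (Fin m) A).map (algebraMap A K) = 1 := by
      simp [Matrix.map_one]
    rw [h1, Matrix.one_mulVec]
  mul_mem' := by
    intro a b ha hb x
    have h : ((a * b : GL (Fin m) A) : Matrix (Fin m) (Fin m) A).map (algebraMap A K)
        = ((a : Matrix (Fin m) (Fin m) A).map (algebraMap A K)) *
          ((b : Matrix (Fin m) (Fin m) A).map (algebraMap A K)) := by
      rw [Units.val_mul, Matrix.map_mul]
    rw [h, ← Matrix.mulVec_mulVec, ha, hb]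
  inv_mem' := by
    intro a ha x
    set M := ((a : Matrix (Fin m) (Fin m) A).map (algebraMap A K)) with hM
    set N := (((a⁻¹ : GL (Fin m) A) : Matrix (Fin m) (Fin m) A).map (algebraMap A K)) with hN
    have hMN : M * N = 1 := by
      rw [hM, hN, ← Matrix.map_mul]
      have : (a : Matrix (Fin m) (Fin m) A) * ((a⁻¹ : GL (Fin m) A) : Matrix (Fin m) (Fin m) A)
          = 1 := a.mul_inv
      rw [this]
      simp [Matrix.map_one]
    have ha' : ∀ y : Fin m → K, qeval Q (M *ᵥ y) = qeval Q y := ha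
    calc qeval Q (N *ᵥ x) = qeval Q (M *ᵥ (N *ᵥ x)) := (ha' (N *ᵥ x)).symm
      _ = qeval Q ((M * N) *ᵥ x) := by rw [Matrix.mulVec_mulVec]
      _ = qeval Q x := by rw [hMN, Matrix.one_mulVec]

/-- `O(f, ℤ)` for a rational quadratic form `f` with Gram matrix `Q`. -/
abbrev OZ {m : ℕ} (Q : Matrix (Fin m) (Fin m) ℚ) : Subgroup (GL (Fin m) ℤ) := ortho ℤ Q

/-- A group is finitely presented: it is a quotient of a finitely generated free group by
the normal closure of a finite set of relators. -/
def IsFinitelyPresented (G : Type*) [Group G] : Prop :=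
  ∃ (n : ℕ) (rels : Set (FreeGroup (Fin n))), rels.Finite ∧ Nonempty (PresentedGroup rels ≃* G)

/-- A group is coherent if each of its finitely generated subgroups is finitely presented. -/
def IsCoherent (G : Type*) [Group G] : Prop :=
  ∀ H : Subgroup G, Group.FG H → IsFinitelyPresented H

/-- Two groups are abstractly commensurable if they contain isomorphic
subgroups of finite index. -/
def AbstractlyCommensurable (G H : Type*) [Group G] [Group H] : Prop :=
  ∃ (G' : Subgroup G) (H' : Subgroup H), G'.FiniteIndex ∧ H'.FiniteIndex ∧ Nonempty (G' ≃* H')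

/-- The form `q₃ = -x₀² + x₁² + x₂² + x₃²`. -/
def q3 : Matrix (Fin 4) (Fin 4) ℚ := Matrix.diagonal ![-1, 1, 1, 1]


open Matrix

/-- The group `O(f, A)` of matrices `M ∈ GL(m, A)` satisfying `Mᵀ Q M = Q`, where `Q`
is the (symmetric) Gram matrix over `K ⊇ A` of the quadratic form `f`. -/
def orthoGram {m : ℕ} (A : Type*) [CommRing A] {K : Type*} [Field K] [Algebra A K]
    (Q : Matrix (Fin m) (Fin m) K) : Subgroup (GL (Fin m) A) where
  carrier := { M | (((M : Matrix (Fin m) (Fin m) A).map (algebraMap A K))ᵀ) * Q *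
      ((M : Matrix (Fin m) (Fin m) A).map (algebraMap A K)) = Q }
  one_mem' := by
    show (((1 : GL (Fin m) A) : Matrix (Fin m) (Fin m) A).map (algebraMap A K))ᵀ * Q *
      (((1 : GL (Fin m) A) : Matrix (Fin m) (Fin m) A).map (algebraMap A K)) = Q
    have h1 : ((1 : GL (Fin m) A) : Matrix (Fin m) (Fin m) A).map (algebraMap A K) = 1 := by
      simp [Matrix.map_one]
    rw [h1]
    simp
  mul_mem' := by
    intro a b ha hb
    show _ = Q
    have h : ((a * b : GL (Fin m) A) : Matrix (Fin m) (Fin m) A).map (algebraMap A K)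
        = ((a : Matrix (Fin m) (Fin m) A).map (algebraMap A K)) *
          ((b : Matrix (Fin m) (Fin m) A).map (algebraMap A K)) := by
      rw [Units.val_mul, Matrix.map_mul]
    set X := ((a : Matrix (Fin m) (Fin m) A).map (algebraMap A K))
    set Y := ((b : Matrix (Fin m) (Fin m) A).map (algebraMap A K))
    have ha' : Xᵀ * Q * X = Q := ha
    have hb' : Yᵀ * Q * Y = Q := hb
    rw [h, Matrix.transpose_mul]
    calc Yᵀ * Xᵀ * Q * (X * Y) = Yᵀ * (Xᵀ * Q * X) * Y := by
          simp only [Matrix.mul_assoc]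
      _ = Q := by rw [ha', hb']
  inv_mem' := by
    intro a ha
    set M := ((a : Matrix (Fin m) (Fin m) A).map (algebraMap A K)) with hMdef
    set N := (((a⁻¹ : GL (Fin m) A) : Matrix (Fin m) (Fin m) A).map (algebraMap A K)) with hNdef
    have hMN : M * N = 1 := by
      rw [hMdef, hNdef, ← Matrix.map_mul]
      have : (a : Matrix (Fin m) (Fin m) A) * ((a⁻¹ : GL (Fin m) A) : Matrix (Fin m) (Fin m) A)
          = 1 := a.mul_inv
      rw [this]
      simp [Matrix.map_one]
    have ha' : Mᵀ * Q * M = Q := ha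
    show Nᵀ * Q * N = Q
    calc Nᵀ * Q * N = Nᵀ * (Mᵀ * Q * M) * N := by rw [ha']
      _ = (M * N)ᵀ * Q * (M * N) := by
          rw [Matrix.transpose_mul]
          simp only [Matrix.mul_assoc]
      _ = Q := by rw [hMN]; simp

noncomputable section

/-- The field `K = ℚ(√5) ⊆ ℝ`. -/
abbrev Ksqrt5 : IntermediateField ℚ ℝ := IntermediateField.adjoin ℚ {Real.sqrt 5}

/-- `√5` as an element of `ℚ(√5)`. -/
def sqrt5 : Ksqrt5 :=
  ⟨Real.sqrt 5, IntermediateField.subset_adjoin ℚ {Real.sqrt 5} rfl⟩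

/-- The ring of integers `A` of `ℚ(√5)`. -/
abbrev Asqrt5 := NumberField.RingOfIntegers Ksqrt5

/-- The Gram matrix of the quadratic form of the right-angled regular 120-cell:
diagonal entries `1`, entries `Q₀₁ = Q₁₀ = Q₃₄ = Q₄₃ = -(1+√5)/4 = -cos(π/5)`,
entries `Q₁₂ = Q₂₁ = Q₂₃ = Q₃₂ = -1/2`, all other entries `0`. -/
def Q120 : Matrix (Fin 5) (Fin 5) Ksqrt5 :=
  !![1, -(1 + sqrt5)/4, 0, 0, 0;
     -(1 + sqrt5)/4, 1, -(1/2), 0, 0;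
     0, -(1/2), 1, -(1/2), 0;
     0, 0, -(1/2), 1, -(1 + sqrt5)/4;
     0, 0, 0, -(1 + sqrt5)/4, 1]

end


noncomputable section

/-- The Gram matrix of the form
`f_a(x₀,...,x_n) = q(x₀,...,x₄) + a·x₅² + x₆² + ... + x_n²` over `ℚ(√5)`. -/
def fA (n a : ℕ) : Matrix (Fin (n + 1)) (Fin (n + 1)) Ksqrt5 :=
  Matrix.of fun i j =>
    if h : (i : ℕ) < 5 ∧ (j : ℕ) < 5 then Q120 ⟨i, h.1⟩ ⟨j, h.2⟩
    else if (i : ℕ) = (j : ℕ) then (if (i : ℕ) = 5 then (a : Ksqrt5) else 1) else 0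

end

end Paper

namespace Paper
section Amalgam

theorem fg_map' {G H : Type*} [Group G] [Group H] (f : G →* H) {K : Subgroup G} (h : K.FG) :
    (K.map f).FG := by
  classical
  obtain ⟨S, rfl⟩ := h
  exact ⟨S.image f, by rw [MonoidHom.map_closure]; simp⟩

theorem ker_fng {F H : Type*} [Group F] [Group H] (f : F →* H) (hf : Function.Surjective f)
    (hF : Group.FG F) (hH : IsFinitelyPresented H) :
    ∃ T : Set F, T.Finite ∧ Subgroup.normalClosure T = f.ker := by
  obtain ⟨n, rels, hr, ⟨e⟩⟩ := hH
  let π : FreeGroup (Fin n) →* H := e.toMonoidHom.comp (PresentedGroup.mk rels)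
  have hπs : Function.Surjective π := e.surjective.comp (QuotientGroup.mk'_surjective _)
  have hπk : ∀ w, π w = 1 → w ∈ Subgroup.normalClosure rels := by
    intro w hw
    have : PresentedGroup.mk rels w = 1 := e.injective (by rw [map_one]; exact hw)
    exact (QuotientGroup.eq_one_iff w).1 this
  have hπr : ∀ w ∈ rels, π w = 1 := by
    intro w hw
    have : PresentedGroup.mk rels w = 1 :=
      (QuotientGroup.eq_one_iff w).2 (Subgroup.subset_normalClosure hw)
    show e _ = 1
    rw [this, map_one]
  choose g hg using hf
  let lam : FreeGroup (Fin n) →* F := FreeGroup.lift (fun i => g (π (FreeGroup.of i)))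
  have hlam : f.comp lam = π := by
    ext i; simp [lam, hg]
  obtain ⟨S, hS⟩ := hF.out
  choose w hw using hπs
  let T : Set F := lam '' rels ∪ (fun x => x⁻¹ * lam (w (f x))) '' (S : Set F)
  refine ⟨T, (hr.image _).union (S.finite_toSet.image _), le_antisymm ?_ ?_⟩
  · apply Subgroup.normalClosure_le_normal
    rintro x (⟨y, hy, rfl⟩ | ⟨y, hy, rfl⟩)
    · show f (lam y) = 1
      rw [← MonoidHom.comp_apply, hlam, hπr y hy]
    · show f _ = 1
      rw [map_mul, ← MonoidHom.comp_apply, hlam, hw]; simp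
  · intro x hx
    have key : ∀ x : F, ∃ u, x⁻¹ * lam u ∈ Subgroup.normalClosure T := by
      intro x
      have : x ∈ Subgroup.closure (S : Set F) := by rw [hS]; trivial
      have hmem : ∀ x y : F, x⁻¹ * y ∈ Subgroup.normalClosure T ↔
        (QuotientGroup.mk' (Subgroup.normalClosure T)) x =
          (QuotientGroup.mk' (Subgroup.normalClosure T)) y := fun x y => QuotientGroup.eq.symm
      simp only [hmem]
      induction this using Subgroup.closure_induction with
      | mem x hx =>
        refine ⟨w (f x), (hmem _ _).1 (Subgroup.subset_normalClosure (Or.inr ⟨x, hx, rfl⟩))⟩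
      | one => exact ⟨1, by simp⟩
      | mul x y _ _ hx hy =>
        obtain ⟨u, hu⟩ := hx; obtain ⟨v, hv⟩ := hy
        exact ⟨u * v, by rw [map_mul, map_mul, map_mul, hu, hv]⟩
      | inv x _ hx =>
        obtain ⟨u, hu⟩ := hx
        exact ⟨u⁻¹, by rw [map_inv, map_inv, map_inv, hu]⟩
    obtain ⟨u, hu⟩ := key x
    have h1 : f (x⁻¹ * lam u) = 1 := by
      have : Subgroup.normalClosure T ≤ f.ker := by
        apply Subgroup.normalClosure_le_normal
        rintro x (⟨y, hy, rfl⟩ | ⟨y, hy, rfl⟩)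
        · show f (lam y) = 1
          rw [← MonoidHom.comp_apply, hlam, hπr y hy]
        · show f _ = 1
          rw [map_mul, ← MonoidHom.comp_apply, hlam, hw]; simp
      exact this hu
    have hx' : f x = 1 := hx
    rw [map_mul, ← MonoidHom.comp_apply, hlam, map_inv, hx', inv_one, one_mul] at h1
    have h2 := hπk u h1
    have h3 : lam u ∈ Subgroup.normalClosure T := by
      have : Subgroup.normalClosure rels ≤ (Subgroup.normalClosure T).comap lam := by
        apply Subgroup.normalClosure_le_normal
        intro y hy
        exact Subgroup.subset_normalClosure (Or.inl ⟨y, hy, rfl⟩)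
      exact this h2
    have h4 := Subgroup.mul_mem _ h3 (Subgroup.inv_mem _ hu)
    simpa using h4

theorem nc_finite {F : Type*} [Group F] (S : Set F) (T : Set F) (hT : T.Finite)
    (h : T ⊆ Subgroup.normalClosure S) :
    ∃ D : Set F, D.Finite ∧ D ⊆ S ∧ T ⊆ Subgroup.normalClosure D := by
  have one : ∀ x ∈ Subgroup.normalClosure S,
      ∃ D : Set F, D.Finite ∧ D ⊆ S ∧ x ∈ Subgroup.normalClosure D := by
    intro x hx
    unfold Subgroup.normalClosure at hx
    induction hx using Subgroup.closure_induction with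
    | mem x hx =>
      obtain ⟨s, hs, hx⟩ := Group.mem_conjugatesOfSet_iff.1 hx
      refine ⟨{s}, Set.finite_singleton s, by simpa using hs, ?_⟩
      exact Subgroup.conjugatesOfSet_subset_normalClosure
        (Group.mem_conjugatesOfSet_iff.2 ⟨s, rfl, hx⟩)
    | one => exact ⟨∅, Set.finite_empty, Set.empty_subset _, Subgroup.one_mem _⟩
    | mul x y _ _ hx hy =>
      obtain ⟨D, h1, h2, h3⟩ := hx
      obtain ⟨E, e1, e2, e3⟩ := hy
      exact ⟨D ∪ E, h1.union e1, Set.union_subset h2 e2, Subgroup.mul_mem _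
        (Subgroup.normalClosure_mono Set.subset_union_left h3)
        (Subgroup.normalClosure_mono Set.subset_union_right e3)⟩
    | inv x _ hx =>
      obtain ⟨D, h1, h2, h3⟩ := hx
      exact ⟨D, h1, h2, Subgroup.inv_mem _ h3⟩
  choose! D h1 h2 h3 using one
  refine ⟨⋃ x ∈ T, D x, hT.biUnion (fun x hx => h1 x (h hx)),
    Set.iUnion₂_subset (fun x hx => h2 x (h hx)), ?_⟩
  intro x hx
  exact Subgroup.normalClosure_mono (Set.subset_biUnion_of_mem hx) (h3 x (h hx))

variable {N : Type*} [Group N]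

/-- the relator identifying the two copies of `c` -/
def arel (c : N) : Monoid.Coprod N N := Monoid.Coprod.inl c * (Monoid.Coprod.inr c)⁻¹

open Classical in
/-- test action -/
noncomputable def tst (C' : Subgroup N) : Monoid.Coprod N N →* Equiv.Perm ((N ⧸ C') × Bool) :=
  let α : N →* Equiv.Perm ((N ⧸ C') × Bool) :=
    { toFun := fun n => Equiv.prodCongr (MulAction.toPerm n) (Equiv.refl Bool)
      map_one' := by ext x <;> simp
      map_mul' := by intro a b; ext x <;> simp [mul_smul] }
  let τ : Equiv.Perm ((N ⧸ C') × Bool) := Equiv.swap (((1 : N) : N ⧸ C'), false) (((1 : N) : N ⧸ C'), true)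
  Monoid.Coprod.lift α ((MulAut.conj τ).toMonoidHom.comp α)

theorem tst_mem (C' : Subgroup N) (c : N) : tst C' (arel c) = 1 ↔ c ∈ C' := by
  classical
  have hmul : ∀ c : N, (c • (((1 : N) : N ⧸ C')) = ((c : N) : N ⧸ C')) := by
    intro c
    rw [MulAction.Quotient.smul_coe]; simp
  have hq : ((c : N) : N ⧸ C') = ((1 : N) : N ⧸ C') ↔ c ∈ C' := by
    rw [QuotientGroup.eq]; simp
  unfold arel
  rw [map_mul, map_inv, mul_inv_eq_one]
  simp only [tst, Monoid.Coprod.lift_apply_inl, Monoid.Coprod.lift_apply_inr]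
  constructor
  · intro h
    by_contra hc
    have h1 := congrArg (fun p => p (((1 : N) : N ⧸ C'), false)) h
    simp [Equiv.swap_apply_left, hmul] at h1
    rw [Equiv.swap_apply_of_ne_of_ne] at h1
    · simp at h1
    · simp
    · simp [hq, hc]
  · intro hc
    have h0 : ((c : N) : N ⧸ C') = ((1 : N) : N ⧸ C') := hq.2 hc
    have hcomm : ∀ (a t : Equiv.Perm ((N ⧸ C') × Bool)), t * a = a * t → a = t * a * t⁻¹ := by
      intro a t h; rw [h]; group
    apply hcomm
    rw [Equiv.swap_mul_eq_mul_swap]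
    congr 2
    · rw [Equiv.Perm.inv_eq_iff_eq]; simp [hmul, h0]
    · rw [Equiv.Perm.inv_eq_iff_eq]; simp [hmul, h0]

/-- copies of `N` in the amalgam -/
def aio (C : Subgroup N) : Bool → N →* (Monoid.Coprod N N ⧸ Subgroup.normalClosure (arel '' (C : Set N)))
  | false => (QuotientGroup.mk' _).comp Monoid.Coprod.inl
  | true => (QuotientGroup.mk' _).comp Monoid.Coprod.inr

theorem aio_eq (C : Subgroup N) {c : N} (hc : c ∈ C) (i j : Bool) : aio C i c = aio C j c := by
  have : aio C false c = aio C true c := by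
    apply mul_inv_eq_one.1
    show (QuotientGroup.mk' (Subgroup.normalClosure (arel '' (C : Set N)))) (arel c) = 1
    exact (QuotientGroup.eq_one_iff _).2 (Subgroup.subset_normalClosure ⟨c, hc, rfl⟩)
  cases i <;> cases j <;> first | rfl | exact this | exact this.symm

/-- reduced words -/
inductive ARed (C : Subgroup N) :
    Bool → (Monoid.Coprod N N ⧸ Subgroup.normalClosure (arel '' (C : Set N))) → Prop
  | base (i : Bool) (n : N) (hn : n ∉ C) : ARed C i (aio C i n)
  | cons (i : Bool) (n : N) (hn : n ∉ C) (g) (hg : ARed C (!i) g) : ARed C i (aio C i n * g)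

theorem ARed.cmul {C : Subgroup N} {i : Bool} {g} (h : ARed C i g) {c : N} (hc : c ∈ C) (j : Bool) :
    ARed C i (aio C j c * g) := by
  rw [aio_eq C hc j i]
  cases h with
  | base _ n hn =>
    rw [← map_mul]; exact ARed.base _ _ (fun h => hn ((Subgroup.mul_mem_cancel_left _ hc).1 h))
  | cons _ n hn g hg =>
    rw [← mul_assoc, ← map_mul]
    exact ARed.cons _ _ (fun h => hn ((Subgroup.mul_mem_cancel_left _ hc).1 h)) _ hg

theorem anf_step {C : Subgroup N} (i : Bool) (n : N) (g)
    (h : (∃ c ∈ C, g = aio C false c) ∨ ∃ j, ARed C j g) :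
    (∃ c ∈ C, aio C i n * g = aio C false c) ∨ ∃ j, ARed C j (aio C i n * g) := by
  by_cases hn : n ∈ C
  · rcases h with ⟨c, hc, rfl⟩ | ⟨j, hj⟩
    · left; exact ⟨n * c, C.mul_mem hn hc, by rw [aio_eq C hn i false, map_mul]⟩
    · right; exact ⟨j, hj.cmul hn i⟩
  · rcases h with ⟨c, hc, rfl⟩ | ⟨j, hj⟩
    · right
      rw [aio_eq C hc false i, ← map_mul]
      exact ⟨i, ARed.base _ _ (fun h => hn ((Subgroup.mul_mem_cancel_right _ hc).1 h))⟩
    · by_cases hij : j = !i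
      · right; subst hij; exact ⟨i, ARed.cons _ _ hn _ hj⟩
      · have : j = i := by revert hij; cases i <;> cases j <;> simp
        subst this
        cases hj with
        | base _ m hm =>
          rw [← map_mul]
          by_cases hnm : n * m ∈ C
          · left; exact ⟨n * m, hnm, aio_eq C hnm _ _⟩
          · right; exact ⟨_, ARed.base _ _ hnm⟩
        | cons _ m hm g hg =>
          right
          rw [← mul_assoc, ← map_mul]
          by_cases hnm : n * m ∈ C
          · exact ⟨_, hg.cmul hnm _⟩
          · exact ⟨_, ARed.cons _ _ hnm _ hg⟩

theorem anf {C : Subgroup N} (g) :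
    (∃ c ∈ C, g = aio C false c) ∨ ∃ j, ARed C j g := by
  induction g using QuotientGroup.induction_on with
  | H x =>
    induction x using Monoid.Coprod.induction_on' with
    | one => left; exact ⟨1, C.one_mem, by rw [map_one]; rfl⟩
    | inl_mul n x hx => exact anf_step false n _ hx
    | inr_mul n x hx => exact anf_step true n _ hx

/-- Main amalgam criterion. -/
theorem amalgam_not_fp {G X : Type*} [Group G] (act : G → X → X)
    (hact : ∀ g h x, act (g * h) x = act g (act h x)) (hact1 : ∀ x, act 1 x = x)
    (N : Subgroup G) (r : G) (hr : r * r = 1) (hN : N.FG) (C : Subgroup N)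
    (hC : ∀ c ∈ C, r * (c : G) * r = c) (hCn : ¬ C.FG)
    (P Q : Set X) (x0 : X) (hxP : x0 ∈ P) (hxQ : x0 ∈ Q)
    (h1 : ∀ n : N, n ∉ C → ∀ x ∈ P, act (n : G) x ∈ Q ∧ act (n : G) x ∉ P)
    (h2 : ∀ n : N, n ∉ C → ∀ x ∈ Q, act (r * n * r) x ∈ P ∧ act (r * n * r) x ∉ Q) :
    ∃ H : Subgroup G, N ≤ H ∧ H.FG ∧ ¬ IsFinitelyPresented H ∧
      ∀ K : Subgroup G, N ≤ K → (∀ n ∈ N, r * n * r ∈ K) → H ≤ K := by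
  classical
  have hri : r⁻¹ = r := inv_eq_of_mul_eq_one_left hr
  let β : N →* G := (MulAut.conj r).toMonoidHom.comp N.subtype
  have hβ : ∀ n : N, β n = r * n * r := by intro n; simp [β, hri]
  let f : Monoid.Coprod N N →* G := Monoid.Coprod.lift N.subtype β
  have hfl : ∀ n, f (Monoid.Coprod.inl n) = n := fun n => by simp [f]
  have hfr : ∀ n, f (Monoid.Coprod.inr n) = r * n * r := fun n => by simp [f, ← hβ]
  have hrel : ∀ c ∈ C, f (arel c) = 1 := by
    intro c hc
    unfold arel
    rw [map_mul, map_inv, hfl, hfr, hC c hc]; simp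
  have hle : Subgroup.normalClosure (arel '' (C : Set N)) ≤ f.ker := by
    apply Subgroup.normalClosure_le_normal
    rintro _ ⟨c, hc, rfl⟩
    exact hrel c hc
  let Φ := QuotientGroup.lift (Subgroup.normalClosure (arel '' (C : Set N))) f hle
  have hΦ0 : ∀ n, Φ (aio C false n) = n := fun n => hfl n
  have hΦ1 : ∀ n, Φ (aio C true n) = r * n * r := fun n => hfr n
  have hred : ∀ i g, ARed C i g →
      (i = false → act (Φ g) x0 ∈ Q ∧ act (Φ g) x0 ∉ P) ∧
      (i = true → act (Φ g) x0 ∈ P ∧ act (Φ g) x0 ∉ Q) := by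
    intro i g hg
    induction hg with
    | base i n hn =>
      refine ⟨?_, ?_⟩ <;> rintro rfl
      · rw [hΦ0]; exact h1 n hn x0 hxP
      · rw [hΦ1]; exact h2 n hn x0 hxQ
    | cons i n hn g hg ih =>
      refine ⟨?_, ?_⟩ <;> rintro rfl
      · rw [map_mul, hΦ0, hact]; exact h1 n hn _ (ih.2 rfl).1
      · rw [map_mul, hΦ1, hact]; exact h2 n hn _ (ih.1 rfl).1
  have hker : f.ker ≤ Subgroup.normalClosure (arel '' (C : Set N)) := by
    intro x hx
    have hx' : f x = 1 := hx
    rw [← QuotientGroup.eq_one_iff]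
    have hΦx : Φ (x : Monoid.Coprod N N ⧸ Subgroup.normalClosure (arel '' (C : Set N))) = 1 := hx'
    rcases anf (C := C) (x : Monoid.Coprod N N ⧸ _) with ⟨c, hc, he⟩ | ⟨j, hj⟩
    · rw [he, hΦ0] at hΦx
      have : c = 1 := Subtype.ext hΦx
      rw [he, this, map_one]
    · exfalso
      have := hred _ _ hj
      rw [hΦx, hact1] at this
      cases j
      · exact (this.1 rfl).2 hxP
      · exact (this.2 rfl).2 hxQ
  have hrange : f.range = N ⊔ N.map (MulAut.conj r).toMonoidHom := by
    rw [Monoid.Coprod.range_lift]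
    simp [β, MonoidHom.range_comp]
  have : Group.FG N := (Group.fg_iff_subgroup_fg N).2 hN
  refine ⟨f.range, ?_, ?_, ?_, ?_⟩
  · rw [hrange]; exact le_sup_left
  · rw [hrange]; exact hN.sup (fg_map' _ hN)
  · intro hfp
    have hFG : Group.FG (Monoid.Coprod N N) := by
      rw [Group.fg_def, ← Monoid.Coprod.range_inl_sup_range_inr]
      rw [MonoidHom.range_eq_map, MonoidHom.range_eq_map]
      exact (fg_map' _ (Group.fg_def.1 this)).sup (fg_map' _ (Group.fg_def.1 this))
    obtain ⟨T, hT, hTk⟩ := ker_fng f.rangeRestrict f.rangeRestrict_surjective hFG hfp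
    rw [MonoidHom.ker_rangeRestrict] at hTk
    obtain ⟨D, hD, hDs, hTD⟩ := nc_finite (arel '' (C : Set N)) T hT
      (fun x hx => hker (by rw [← hTk]; exact Subgroup.subset_normalClosure hx))
    choose! c hcC hca using hDs
    have hE : (c '' D).Finite := hD.image c
    have hC' : Subgroup.closure (c '' D) ≤ C := by
      rw [Subgroup.closure_le]; rintro _ ⟨d, hd, rfl⟩; exact hcC hd
    have hne : Subgroup.closure (c '' D) ≠ C := by
      intro h
      exact hCn ⟨hE.toFinset, by simpa using h⟩
    obtain ⟨y, hyC, hy⟩ := SetLike.exists_of_lt (lt_of_le_of_ne hC' hne)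
    apply hy
    rw [← tst_mem]
    have hy2 : arel y ∈ f.ker := hrel y hyC
    rw [← hTk] at hy2
    have : Subgroup.normalClosure T ≤ (tst (Subgroup.closure (c '' D))).ker := by
      apply Subgroup.normalClosure_le_normal
      intro t ht
      have h3 : Subgroup.normalClosure D ≤ (tst (Subgroup.closure (c '' D))).ker := by
        apply Subgroup.normalClosure_le_normal
        intro d hd
        show tst _ d = 1
        rw [← hca hd, tst_mem]
        exact Subgroup.subset_closure ⟨d, hd, rfl⟩
      exact h3 (hTD ht)
    exact this hy2
  · intro K hK1 hK2
    rw [hrange]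
    refine sup_le hK1 ?_
    rintro _ ⟨n, hn, rfl⟩
    simpa [hri] using hK2 n hn

end Amalgam
end Paper

namespace Paper
section Legal

/-- bitmask of neighbours in the icosahedron -/
def nbm : Fin 12 → ℕ
  | 0 => 230 | 1 => 397 | 2 => 339 | 3 => 2946 | 4 => 1860 | 5 => 3265
  | 6 => 1077 | 7 => 2091 | 8 => 542 | 9 => 3352 | 10 => 2672 | 11 => 1704

/-- adjacency in the icosahedron -/
def iadj (s t : Fin 12) : Bool := (nbm s).testBit t

/-- the moves of the legal system -/
def mvs : Fin 12 → ℕ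
  | 0 => 1 | 1 => 2 | 2 => 4 | 3 => 1 | 4 => 8 | 5 => 16
  | 6 => 18 | 7 => 29 | 8 => 16 | 9 => 7 | 10 => 1 | 11 => 18

/-- next state -/
def nxt (s : Fin 12) (k : Fin 32) : Fin 32 := ⟨(k.1 ^^^ mvs s) % 32, Nat.mod_lt _ (by decide)⟩

/-- the subset attached to a state, as a bitmask -/
def stm (k : Fin 32) : ℕ :=
  31 ^^^ (cond (k.1.testBit 0) 1033 0) ^^^ (cond (k.1.testBit 1) 2146 0) ^^^
    (cond (k.1.testBit 2) 3628 0) ^^^ (cond (k.1.testBit 3) 2193 0) ^^^ (cond (k.1.testBit 4) 288 0)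

/-- is `s` ascending in state `k` -/
def isUp (s : Fin 12) (k : Fin 32) : Bool := (stm k).testBit s

/-- height change -/
def dlt (s : Fin 12) (k : Fin 32) : ℤ := cond (isUp s k) 1 (-1)

theorem iadj_symm : ∀ s t, iadj s t = iadj t s := by decide +kernel
theorem nxt_nxt : ∀ s k, nxt s (nxt s k) = k := by decide +kernel
theorem nxt_comm : ∀ s t k, nxt s (nxt t k) = nxt t (nxt s k) := by decide +kernel
theorem isUp_self : ∀ s k, isUp s (nxt s k) = !isUp s k := by decide +kernel
theorem isUp_adj : ∀ s t k, iadj s t = true → isUp s (nxt t k) = isUp s k := by decide +kernel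
theorem legal : ∀ (b : Bool) (k : Fin 32), ∃ r, isUp r k = b ∧ ∀ s, isUp s k = b →
    (s = r ∨ iadj s r = true ∨ ∃ u, isUp u k = b ∧ iadj s u = true ∧ iadj u r = true) := by
  decide +kernel

theorem dlt_self (s k) : dlt s (nxt s k) = - dlt s k := by
  unfold dlt; rw [isUp_self]; cases isUp s k <;> rfl
theorem dlt_adj (s t k) (h : iadj s t = true) : dlt s (nxt t k) = dlt s k := by
  unfold dlt; rw [isUp_adj s t k h]

/-- relators of the right-angled Coxeter group of the icosahedral graph -/
def wrels : Set (FreeGroup (Fin 12)) :=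
  {x | ∃ s, x = FreeGroup.of s * FreeGroup.of s} ∪
  {x | ∃ s t, iadj s t = true ∧ x = FreeGroup.of s * FreeGroup.of t * (FreeGroup.of s)⁻¹ * (FreeGroup.of t)⁻¹}

/-- right-angled Coxeter group -/
abbrev WW := PresentedGroup wrels

/-- generators -/
def sg (s : Fin 12) : WW := PresentedGroup.of s

theorem sg_sq (s) : sg s * sg s = 1 := by
  show PresentedGroup.mk wrels (FreeGroup.of s * FreeGroup.of s) = 1
  exact (QuotientGroup.eq_one_iff _).2 (Subgroup.subset_normalClosure (Or.inl ⟨s, rfl⟩))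

theorem sg_comm (s t) (h : iadj s t = true) : sg s * sg t = sg t * sg s := by
  have : sg s * sg t * (sg s)⁻¹ * (sg t)⁻¹ = 1 := by
    show PresentedGroup.mk wrels
      (FreeGroup.of s * FreeGroup.of t * (FreeGroup.of s)⁻¹ * (FreeGroup.of t)⁻¹) = 1
    exact (QuotientGroup.eq_one_iff _).2 (Subgroup.subset_normalClosure (Or.inr ⟨s, t, h, rfl⟩))
  rw [mul_inv_eq_one, mul_inv_eq_iff_eq_mul] at this
  exact this

theorem sg_inv (s) : (sg s)⁻¹ = sg s := inv_eq_of_mul_eq_one_left (sg_sq s)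

theorem sg_cancel (s) (w : WW) : sg s * (sg s * w) = w := by rw [← mul_assoc, sg_sq, one_mul]

/-- homs out of `WW` -/
def whom {G : Type*} [Group G] (f : Fin 12 → G) (h1 : ∀ s, f s * f s = 1)
    (h2 : ∀ s t, iadj s t = true → f s * f t = f t * f s) : WW →* G :=
  PresentedGroup.toGroup (f := f) (rels := wrels) (by
    rintro r (⟨s, rfl⟩ | ⟨s, t, h, rfl⟩)
    · simpa using h1 s
    · simp [h2 s t h])

theorem whom_sg {G : Type*} [Group G] (f : Fin 12 → G) (h1 : ∀ s, f s * f s = 1)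
    (h2 : ∀ s t, iadj s t = true → f s * f t = f t * f s) (s) : whom f h1 h2 (sg s) = f s :=
  PresentedGroup.toGroup.of _

theorem ww_induction {p : WW → Prop} (h1 : p 1) (h2 : ∀ s w, p w → p (sg s * w)) (w : WW) : p w := by
  have hw : w ∈ Subgroup.closure (Set.range (PresentedGroup.of (rels := wrels))) := by
    rw [PresentedGroup.closure_range_of]; trivial
  refine Subgroup.closure_induction_left (p := fun w _ => p w) h1 ?_ ?_ hw
  · rintro _ ⟨s, rfl⟩ y _ hy; exact h2 s y hy
  · rintro _ ⟨s, rfl⟩ y _ hy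
    have := h2 s y hy
    rw [← sg_inv] at this; exact this

/-- permutation given by an involution -/
def invPerm {Y : Type*} (f : Y → Y) (h : ∀ y, f (f y) = y) : Equiv.Perm Y := ⟨f, f, h, h⟩

/-- action on `ℤ × Fin 32` -/
def thf (s : Fin 12) (x : ℤ × Fin 32) : ℤ × Fin 32 := (x.1 + dlt s x.2, nxt s x.2)

theorem thf_inv (s x) : thf s (thf s x) = x := by
  ext <;> simp [thf, dlt_self, nxt_nxt]

/-- action on `ℤ × Fin 32` -/
def th : WW →* Equiv.Perm (ℤ × Fin 32) := whom (fun s => invPerm (thf s) (thf_inv s))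
  (fun s => by ext x <;> simp [invPerm, thf_inv])
  (fun s t h => by
    have h' := h; rw [iadj_symm] at h'
    apply Equiv.ext; intro x
    show thf s (thf t x) = thf t (thf s x)
    unfold thf
    ext
    · simp only [dlt_adj _ _ _ h, dlt_adj _ _ _ h']; ring
    · simp only [nxt_comm s t])

theorem th_sg (s w x) : th (sg s * w) x = thf s (th w x) := by
  rw [map_mul]; unfold th; rw [whom_sg]; rfl

/-- height -/
def ht (w : WW) : ℤ := (th w (0, 0)).1
/-- state -/
def sta (w : WW) : Fin 32 := (th w (0, 0)).2

theorem ht_sg (s w) : ht (sg s * w) = ht w + dlt s (sta w) := by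
  unfold ht sta; rw [th_sg]; rfl
theorem sta_sg (s w) : sta (sg s * w) = nxt s (sta w) := by
  unfold sta; rw [th_sg]; rfl
theorem ht_one : ht 1 = 0 := by simp [ht]

/-- a step in the band -/
def bstep (a b : ℤ) (w w' : WW) : Prop :=
  ∃ s, w' = sg s * w ∧ a ≤ ht w ∧ ht w ≤ b ∧ a ≤ ht w' ∧ ht w' ≤ b

/-- connected in the band -/
def bconn (a b : ℤ) : WW → WW → Prop := Relation.ReflTransGen (bstep a b)

theorem bconn_mono {a b a' b' : ℤ} (h1 : a' ≤ a) (h2 : b ≤ b') {w w' : WW} (h : bconn a b w w') :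
    bconn a' b' w w' := by
  induction h with
  | refl => exact Relation.ReflTransGen.refl
  | tail _ h2 ih =>
    obtain ⟨s, h, h3, h4, h5, h6⟩ := h2
    exact ih.tail ⟨s, h, by lia, by lia, by lia, by lia⟩

theorem bconn_any (w : WW) : ∃ M : ℤ, 0 ≤ M ∧ bconn (-M) M 1 w := by
  suffices ∃ M : ℤ, 0 ≤ M ∧ |ht w| ≤ M ∧ bconn (-M) M 1 w by
    obtain ⟨M, h1, h2, h3⟩ := this; exact ⟨M, h1, h3⟩
  induction w using ww_induction with
  | h1 => exact ⟨0, le_refl _, by rw [ht_one]; simp, Relation.ReflTransGen.refl⟩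
  | h2 s w ih =>
    obtain ⟨M, h0, h1, h2⟩ := ih
    refine ⟨max M |ht (sg s * w)|, by lia, le_max_right _ _, ?_⟩
    refine Relation.ReflTransGen.tail (bconn_mono (b := M) (a := -M) (by lia) (by lia) h2) ?_
    have h3 := abs_le.1 h1
    have h4 := abs_le.1 (le_refl |ht (sg s * w)|)
    exact ⟨s, rfl, by lia, by lia, by lia, by lia⟩

theorem chain2 (bb : Bool) (a b : ℤ) (y : WW) (s t : Fin 12) (hs : isUp s (sta y) = bb)
    (ht' : isUp t (sta y) = bb) (h : iadj s t = true)
    (hb : a ≤ ht y + 2 * cond bb 1 (-1) ∧ a ≤ ht y + cond bb 1 (-1) ∧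
      ht y + 2 * cond bb 1 (-1) ≤ b ∧ ht y + cond bb 1 (-1) ≤ b) :
    bconn a b (sg s * y) (sg t * y) := by
  have h' := h; rw [iadj_symm] at h'
  have e1 : ht (sg s * y) = ht y + cond bb 1 (-1) := by rw [ht_sg, dlt, hs]
  have e2 : ht (sg t * y) = ht y + cond bb 1 (-1) := by rw [ht_sg, dlt, ht']
  have e3 : ht (sg t * (sg s * y)) = ht y + 2 * cond bb 1 (-1) := by
    rw [ht_sg, sta_sg, dlt_adj _ _ _ h', e1, dlt, ht']; ring
  refine Relation.ReflTransGen.tail (b := sg t * (sg s * y)) (Relation.ReflTransGen.single ?_) ?_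
  · exact ⟨t, rfl, by lia, by lia, by lia, by lia⟩
  · refine ⟨s, ?_, by lia, by lia, by lia, by lia⟩
    rw [← mul_assoc (sg t), ← sg_comm s t h, mul_assoc, sg_cancel]

theorem bconn_symm {a b : ℤ} {x y : WW} (h : bconn a b x y) : bconn a b y x := by
  induction h with
  | refl => exact Relation.ReflTransGen.refl
  | tail _ h2 ih =>
    obtain ⟨s, h, h3, h4, h5, h6⟩ := h2
    exact Relation.ReflTransGen.head ⟨s, by rw [h, sg_cancel], h5, h6, h3, h4⟩ ih

theorem chain (bb : Bool) (a b : ℤ) (y : WW) (s t : Fin 12) (hs : isUp s (sta y) = bb)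
    (ht' : isUp t (sta y) = bb)
    (hb : a ≤ ht y + 2 * cond bb 1 (-1) ∧ a ≤ ht y + cond bb 1 (-1) ∧
      ht y + 2 * cond bb 1 (-1) ≤ b ∧ ht y + cond bb 1 (-1) ≤ b) :
    bconn a b (sg s * y) (sg t * y) := by
  obtain ⟨r, hr, h⟩ := legal bb (sta y)
  have key : ∀ s, isUp s (sta y) = bb → bconn a b (sg s * y) (sg r * y) := by
    intro s hs
    rcases h s hs with rfl | h | ⟨u, hu, h1, h2⟩
    · exact Relation.ReflTransGen.refl
    · exact chain2 bb a b y s r hs hr h hb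
    · exact (chain2 bb a b y s u hs hu h1 hb).trans (chain2 bb a b y u r hu hr h2 hb)
  exact (key s hs).trans (bconn_symm (key t ht'))

theorem push_down (a b : ℤ) (hab : a + 1 ≤ b) (x y : WW) (hx : ht x ≤ b)
    (h : bconn a (b + 1) x y) :
    (ht y ≤ b → bconn a b x y) ∧
    (ht y = b + 1 → ∀ s, isUp s (sta y) = false → bconn a b x (sg s * y)) := by
  induction h with
  | refl => exact ⟨fun _ => Relation.ReflTransGen.refl, fun h => by lia⟩
  | tail h1 h2 ih =>
    rename_i y z
    obtain ⟨s, hz, g1, g2, g3, g4⟩ := h2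
    have hzs : sg s * z = y := by rw [hz, sg_cancel]
    have e1 := ht_sg s y
    rw [← hz] at e1
    have e2 : isUp s (sta z) = ! isUp s (sta y) := by rw [hz, sta_sg, isUp_self]
    have e3 : dlt s (sta y) = 1 ∨ dlt s (sta y) = -1 := by
      unfold dlt; cases isUp s (sta y) <;> simp
    rcases eq_or_lt_of_le g2 with hy | hy
    · have hd : isUp s (sta y) = false := by
        cases hh : isUp s (sta y)
        · rfl
        · simp [dlt, hh] at e1; lia
      simp [dlt, hd] at e1
      refine ⟨fun _ => ?_, fun h => by lia⟩
      rw [hz]; exact ih.2 hy s hd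
    · have hy' : ht y ≤ b := by lia
      refine ⟨fun hzb => (ih.1 hy').tail ⟨s, hz, g1, hy', g3, hzb⟩, fun hzb t htz => ?_⟩
      have hu : isUp s (sta y) = true := by
        cases hh : isUp s (sta y)
        · simp [dlt, hh] at e1; lia
        · rfl
      have := ih.1 hy'
      refine this.trans ?_
      rw [← hzs]
      exact chain false a b z s t (by rw [e2, hu]; rfl) htz ⟨by simp; lia, by simp; lia, by simp; lia, by simp; lia⟩

theorem push_up (a b : ℤ) (hab : a + 1 ≤ b) (x y : WW) (hx : a ≤ ht x)
    (h : bconn (a - 1) b x y) :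
    (a ≤ ht y → bconn a b x y) ∧
    (ht y = a - 1 → ∀ s, isUp s (sta y) = true → bconn a b x (sg s * y)) := by
  induction h with
  | refl => exact ⟨fun _ => Relation.ReflTransGen.refl, fun h => by lia⟩
  | tail h1 h2 ih =>
    rename_i y z
    obtain ⟨s, hz, g1, g2, g3, g4⟩ := h2
    have hzs : sg s * z = y := by rw [hz, sg_cancel]
    have e1 := ht_sg s y
    rw [← hz] at e1
    have e2 : isUp s (sta z) = ! isUp s (sta y) := by rw [hz, sta_sg, isUp_self]
    rcases eq_or_lt_of_le g1 with hy | hy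
    · have hd : isUp s (sta y) = true := by
        cases hh : isUp s (sta y)
        · simp [dlt, hh] at e1; lia
        · rfl
      simp [dlt, hd] at e1
      refine ⟨fun _ => ?_, fun h => by lia⟩
      rw [hz]; exact ih.2 hy.symm s hd
    · have hy' : a ≤ ht y := by lia
      refine ⟨fun hzb => (ih.1 hy').tail ⟨s, hz, hy', g2, hzb, g4⟩, fun hzb t htz => ?_⟩
      have hu : isUp s (sta y) = false := by
        cases hh : isUp s (sta y)
        · rfl
        · simp [dlt, hh] at e1; lia
      have := ih.1 hy'
      refine this.trans ?_
      rw [← hzs]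
      exact chain true a b z s t (by rw [e2, hu]; rfl) htz ⟨by simp; lia, by simp; lia, by simp; lia, by simp; lia⟩

theorem bconn01 (w : WW) (h : ht w = 0) : bconn 0 1 1 w := by
  obtain ⟨M, hM, hc⟩ := bconn_any w
  have h1 : ∀ n : ℕ, bconn (-M) (1 + n) 1 w → bconn (-M) 1 1 w := by
    intro n
    induction n with
    | zero => intro h; simpa using h
    | succ n ih =>
      intro hh
      apply ih
      exact (push_down (-M) (1 + n) (by lia) 1 w (by rw [ht_one]; lia)
        (by push_cast at hh; rw [← add_assoc] at hh; exact hh)).1 (by lia)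
  have h2 : ∀ n : ℕ, bconn (-(n : ℤ)) 1 1 w → bconn 0 1 1 w := by
    intro n
    induction n with
    | zero => intro h; simpa using h
    | succ n ih =>
      intro hh
      apply ih
      exact (push_up (-(n : ℤ)) 1 (by lia) 1 w (by rw [ht_one]; lia)
        (by push_cast at hh; rw [neg_add] at hh; exact hh)).1 (by lia)
  refine h2 M.toNat ?_
  rw [Int.toNat_of_nonneg hM]
  refine h1 M.toNat ?_
  rw [Int.toNat_of_nonneg hM]
  exact bconn_mono (le_refl _) (by lia) hc

/-- stabiliser of base point -/
def N0 : Subgroup WW where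
  carrier := {w | th w (0, 0) = (0, 0)}
  one_mem' := by simp
  mul_mem' := by intro a b ha hb; simp only [Set.mem_ofPred_eq] at *; rw [map_mul, Equiv.Perm.mul_apply, hb, ha]
  inv_mem' := by intro a ha; simp only [Set.mem_ofPred_eq] at *; rw [map_inv, Equiv.Perm.inv_eq_iff_eq, ha]

theorem mem_N0 (w) : w ∈ N0 ↔ th w (0, 0) = (0, 0) := Iff.rfl

theorem N0_fg : N0.FG := by
  classical
  let f : ℤ × Fin 32 → WW := fun y =>
    if y = (0, 0) then 1 else if h : ∃ w, th w (0, 0) = y then h.choose else 1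
  have hf : ∀ w, th (f (th w (0, 0))) (0, 0) = th w (0, 0) := by
    intro w
    simp only [f]
    split_ifs with h1 h2
    · rw [h1]; simp
    · exact h2.choose_spec
    · exact absurd ⟨w, rfl⟩ h2
  have hf1 : f (0, 0) = 1 := by simp [f]
  let G : Set WW := (fun p : Fin 12 × Bool × Fin 32 =>
    (f (thf p.1 (cond p.2.1 1 0, p.2.2)))⁻¹ * sg p.1 * f (cond p.2.1 1 0, p.2.2)) '' Set.univ ∩ N0
  have hG : G.Finite := (Set.finite_univ.image _).inter_of_left _
  have key : ∀ w, bconn 0 1 1 w → (f (th w (0, 0)))⁻¹ * w ∈ Subgroup.closure G := by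
    intro w hw
    induction hw with
    | refl => simp [hf1]
    | tail h1 h2 ih =>
      rename_i y z
      obtain ⟨s, hz, g1, g2, g3, g4⟩ := h2
      have : (f (th z (0, 0)))⁻¹ * z =
          ((f (th z (0, 0)))⁻¹ * sg s * f (th y (0, 0))) * ((f (th y (0, 0)))⁻¹ * y) := by
        rw [hz]; group
      rw [this]
      refine Subgroup.mul_mem _ (Subgroup.subset_closure ⟨⟨⟨s, decide (ht y = 1), sta y⟩, trivial, ?_⟩, ?_⟩) ih
      · have hy : ((cond (decide (ht y = 1)) 1 0, sta y) : ℤ × Fin 32) = th y (0, 0) := by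
          ext
          · show _ = ht y
            by_cases h : ht y = 1
            · simp [h]
            · have : ht y = 0 := by lia
              simp [this]
          · rfl
        dsimp only
        rw [hy, ← th_sg, ← hz]
      · show th _ _ = _
        rw [map_mul, map_mul, map_inv, Equiv.Perm.mul_apply, Equiv.Perm.mul_apply,
          Equiv.Perm.inv_eq_iff_eq, hf, hf, hz, map_mul, Equiv.Perm.mul_apply]
  refine ⟨hG.toFinset, ?_⟩
  rw [Set.Finite.coe_toFinset]
  apply le_antisymm
  · rw [Subgroup.closure_le]; exact Set.inter_subset_right
  · intro w hw
    have := key w (bconn01 w (by unfold ht; rw [(mem_N0 w).1 hw]))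
    rw [(mem_N0 w).1 hw, hf1] at this
    simpa using this

end Legal
end Paper

namespace Paper
section Cocycle

/-- support of the cocycle -/
def cmp (s : Fin 12) (k : Fin 32) : Bool :=
  let l := cond (isUp s k) k (nxt s k)
  (l == 0 && s == 0) || (l == 19 && (s == 10 || s == 6 || s == 11)) || (l == 28 && s == 7)

theorem cmp_self : ∀ s k, cmp s (nxt s k) = cmp s k := by decide +kernel
theorem cmp_sq : ∀ s t k, iadj 5 s = true → iadj 5 t = true → iadj s t = true →
    (isUp s k = isUp t k → cmp s k = cmp t k ∧ cmp t (nxt s k) = cmp s (nxt t k)) ∧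
    (isUp s k ≠ isUp t k → cmp s k = cmp t (nxt s k) ∧ cmp t k = cmp s (nxt t k)) := by
  decide +kernel

/-- level of an edge -/
def lev (s : Fin 12) (x : ℤ × Fin 32) : ℤ := x.1 + cond (isUp s x.2) 0 (-1)

/-- contribution of an edge -/
def ctr (s : Fin 12) (x : ℤ × Fin 32) (i : ℤ) : ZMod 2 :=
  cond (cmp s x.2 && decide (i = lev s x)) 1 0

theorem lev_self (s x) : lev s (thf s x) = lev s x := by
  simp only [lev, thf, isUp_self, dlt]; cases isUp s x.2 <;> simp

theorem ctr_self (s x i) : ctr s (thf s x) i = ctr s x i := by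
  unfold ctr; rw [lev_self]; simp only [thf, cmp_self]

theorem ctr_sq (s t x i) (hs : iadj 5 s = true) (ht : iadj 5 t = true) (h : iadj s t = true) :
    ctr s x i + ctr t (thf s x) i = ctr t x i + ctr s (thf t x) i := by
  have h' := h; rw [iadj_symm] at h'
  obtain ⟨h1, h2⟩ := cmp_sq s t x.2 hs ht h
  unfold ctr lev thf dlt
  simp only [isUp_adj _ _ _ h, isUp_adj _ _ _ h']
  cases hU : isUp s x.2 <;> cases hV : isUp t x.2 <;> rw [hU, hV] at h1 h2 <;> simp at h1 h2 <;>
    simp [h1, h2, CharTwo.add_self_eq_zero]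

/-- the extended space -/
abbrev YY := (ℤ × Fin 32) × (ℤ → ZMod 2)

/-- generators on the extended space -/
def ygf (s : Fin 12) (y : YY) : YY :=
  cond (iadj 5 s) (thf s y.1, fun i => y.2 i + ctr s y.1 i) y

theorem zm2 (a b : ZMod 2) : a + b + b = a := by
  revert a b; decide

theorem ygf_inv (s y) : ygf s (ygf s y) = y := by
  unfold ygf
  cases h : iadj 5 s
  · rfl
  · simp only [cond_true, thf_inv, ctr_self, zm2]

/-- action on the extended space -/
def yh : WW →* Equiv.Perm YY := whom (fun s => invPerm (ygf s) (ygf_inv s))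
  (fun s => by apply Equiv.ext; intro x; exact ygf_inv s x)
  (fun s t h => by
    have h' := h; rw [iadj_symm] at h'
    apply Equiv.ext; intro y
    show ygf s (ygf t y) = ygf t (ygf s y)
    unfold ygf
    cases hs : iadj 5 s
    · simp
    · cases ht : iadj 5 t
      · simp
      · simp only [cond_true]
        ext i
        · simp only [thf, dlt_adj _ _ _ h, dlt_adj _ _ _ h']; ring
        · simp only [thf, nxt_comm s t]
        · have := ctr_sq s t y.1 i hs ht h
          simp only [add_assoc, this])

theorem yh_sg (s w y) : yh (sg s * w) y = ygf s (yh w y) := by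
  rw [map_mul]; unfold yh; rw [whom_sg]; rfl

/-- translation plus addition -/
def ytr (j : ℤ) (a : ℤ → ZMod 2) (y : YY) : YY := ((y.1.1 + j, y.1.2), fun i => y.2 (i - j) + a i)

theorem ctr_tr (s x j i) : ctr s (x.1 + j, x.2) i = ctr s x (i - j) := by
  unfold ctr lev
  have : (i = x.1 + j + cond (isUp s x.2) 0 (-1)) ↔ (i - j = x.1 + cond (isUp s x.2) 0 (-1)) := by
    constructor <;> intro h <;> lia
  simp only [this]

theorem yh_tr (w j a y) : yh w (ytr j a y) = ytr j a (yh w y) := by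
  induction w using ww_induction with
  | h1 => simp
  | h2 s w ih =>
    rw [yh_sg, yh_sg, ih]
    generalize yh w y = z
    unfold ygf ytr
    cases h : iadj 5 s
    · rfl
    · simp only [cond_true, ctr_tr]
      ext i
      · simp only [thf]; ring
      · rfl
      · simp only []; ring

theorem yh_supp (w y) : ∃ M : ℤ, ∀ i, M < |i| → (yh w y).2 i = y.2 i := by
  induction w using ww_induction with
  | h1 => exact ⟨0, by simp⟩
  | h2 s w ih =>
    obtain ⟨M, hM⟩ := ih
    rw [yh_sg]
    generalize yh w y = z at *
    refine ⟨max M |lev s z.1|, fun i hi => ?_⟩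
    unfold ygf
    cases h : iadj 5 s
    · exact hM i (by lia)
    · simp only [cond_true, ctr]
      have : i ≠ lev s z.1 := by rintro rfl; lia
      simp [this, hM i (by lia)]

/-- the pentagon subgroup -/
def Wp : Subgroup WW := Subgroup.closure (sg '' {s | iadj 5 s = true})

theorem yh_fst (w) (hw : w ∈ Wp) (y) : (yh w y).1 = th w y.1 := by
  unfold Wp at hw
  induction hw using Subgroup.closure_induction_left with
  | one => simp
  | mul_left x hx y' hy' ih =>
    obtain ⟨s, hs, rfl⟩ := hx
    have hs' : iadj 5 s = true := hs
    rw [yh_sg, th_sg, ← ih]; simp [ygf, hs']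
  | inv_mul_cancel x hx y' hy' ih =>
    obtain ⟨s, hs, rfl⟩ := hx
    have hs' : iadj 5 s = true := hs
    rw [sg_inv, yh_sg, th_sg, ← ih]; simp [ygf, hs']

/-- base point -/
def y00 : YY := ((0, 0), fun _ => 0)

/-- the translation element -/
def tel : WW := sg 10 * (sg 0 * 1)
/-- the loop -/
def lel : WW := sg 0 * (sg 10 * (sg 7 * (sg 10 * (sg 7 * (sg 0 * 1)))))

theorem sgp (s : Fin 12) (h : iadj 5 s = true) : sg s ∈ Wp := Subgroup.subset_closure ⟨s, h, rfl⟩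

theorem tel_mem : tel ∈ Wp :=
  Wp.mul_mem (sgp _ rfl) (Wp.mul_mem (sgp _ rfl) Wp.one_mem)
theorem lel_mem : lel ∈ Wp :=
  Wp.mul_mem (sgp _ rfl) (Wp.mul_mem (sgp _ rfl) (Wp.mul_mem (sgp _ rfl) (Wp.mul_mem (sgp _ rfl) (Wp.mul_mem (sgp _ rfl) (Wp.mul_mem (sgp _ rfl) Wp.one_mem)))))

theorem tel_th : th tel (0, 0) = (2, 0) := by
  unfold tel; simp only [th_sg, map_one, Equiv.Perm.one_apply]; decide +kernel
theorem lel_th : th lel (0, 0) = (0, 0) := by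
  unfold lel; simp only [th_sg, map_one, Equiv.Perm.one_apply]; decide +kernel
theorem lel_y : (yh lel y00).2 0 = 1 := by
  unfold lel; simp only [yh_sg, map_one, Equiv.Perm.one_apply]; decide +kernel

theorem y_of_fst (y : YY) (j : ℤ) (h : y.1 = (j, 0)) : y = ytr j y.2 y00 := by
  ext i
  · rw [h]; simp [ytr, y00]
  · rw [h]; simp [ytr, y00]
  · simp [ytr, y00]

theorem telpow (n : ℕ) : th (tel ^ n) (0, 0) = (2 * (n : ℤ), 0) := by
  have h2 : ∀ (w : WW) (hw : w ∈ Wp) (j : ℤ) (x : ℤ × Fin 32), th w (x.1 + j, x.2) = ((th w x).1 + j, (th w x).2) := by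
    intro w hw j x
    have := yh_tr w j 0 (x, 0)
    have h3 := congrArg Prod.fst this
    rw [yh_fst w hw] at h3
    simp only [ytr] at h3
    rw [yh_fst w hw] at h3
    exact h3
  induction n with
  | zero => simp
  | succ n ih =>
    rw [pow_succ', map_mul, Equiv.Perm.mul_apply, ih]
    have := h2 tel tel_mem (2 * n) (0, 0)
    simp only [tel_th, zero_add] at this
    rw [this]; push_cast; ring_nf

theorem conj_y (n : ℕ) (d : ℤ → ZMod 2) (hd : yh lel y00 = ytr 0 d y00) :
    yh ((tel ^ n)⁻¹ * lel * tel ^ n) y00 = ytr 0 (fun i => d (i - 2 * n)) y00 := by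
  have h1 : (yh (tel ^ n) y00).1 = (2 * (n : ℤ), 0) := by
    rw [yh_fst _ (Wp.pow_mem tel_mem n)]; exact telpow n
  have h2 := y_of_fst _ _ h1
  rw [map_mul, map_mul, map_inv, Equiv.Perm.mul_apply, Equiv.Perm.mul_apply, Equiv.Perm.inv_eq_iff_eq]
  rw [yh_tr, h2, yh_tr, hd]
  ext i
  · simp [ytr, y00]
  · simp [ytr, y00]
  · simp [ytr, y00]; ring

/-- Part IV -/
theorem C0_not_fg {F : Type*} [Group F] [Finite F] (ψ : WW →* F) :
    ¬ (Wp ⊓ N0 ⊓ ψ.ker).FG := by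
  rintro ⟨S, hS⟩
  -- bounded subgroup
  let BM : ℤ → Subgroup WW := fun M =>
    { carrier := {w | ∃ d : ℤ → ZMod 2, yh w y00 = ytr 0 d y00 ∧ ∀ i, M < |i| → d i = 0}
      one_mem' := ⟨0, by simp [ytr], by simp⟩
      mul_mem' := by
        rintro a b ⟨d, hd, hd'⟩ ⟨e, he, he'⟩
        refine ⟨d + e, ?_, fun i hi => by simp [hd' i hi, he' i hi]⟩
        rw [map_mul, Equiv.Perm.mul_apply, he, yh_tr, hd]
        simp [ytr, y00, add_comm]
      inv_mem' := by
        rintro a ⟨d, hd, hd'⟩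
        refine ⟨d, ?_, fun i hi => by simp [hd' i hi]⟩
        rw [map_inv, Equiv.Perm.inv_eq_iff_eq, yh_tr, hd]
        simp [ytr, y00, CharTwo.add_self_eq_zero] }
  have hmem : ∀ w, w ∈ Wp → w ∈ N0 → ∃ d : ℤ → ZMod 2, yh w y00 = ytr 0 d y00 := by
    intro w hw hn
    refine ⟨_, y_of_fst _ 0 ?_⟩
    rw [yh_fst _ hw]; exact hn
  have hM : ∃ M : ℤ, ∀ w ∈ S, w ∈ BM M := by
    have : ∀ w ∈ S, ∃ M : ℤ, w ∈ BM M := by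
      intro w hw
      have hw' : w ∈ Wp ⊓ N0 ⊓ ψ.ker := by rw [← hS]; exact Subgroup.subset_closure hw
      obtain ⟨d, hd⟩ := hmem w hw'.1.1 hw'.1.2
      obtain ⟨M, hM⟩ := yh_supp w y00
      refine ⟨M, d, hd, fun i hi => ?_⟩
      have := hM i hi
      rw [hd] at this
      simpa [ytr, y00] using this
    choose! M hM using this
    obtain ⟨K, hK⟩ := (S.finite_toSet.image M).bddAbove
    refine ⟨K, fun w hw => ?_⟩
    obtain ⟨d, hd, hd'⟩ := hM w hw
    have : M w ≤ K := hK ⟨w, hw, rfl⟩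
    exact ⟨d, hd, fun i hi => hd' i (by lia)⟩
  obtain ⟨M, hM⟩ := hM
  have hle : Wp ⊓ N0 ⊓ ψ.ker ≤ BM M := by
    rw [← hS, Subgroup.closure_le]; exact hM
  obtain ⟨d, hd⟩ := hmem lel lel_mem lel_th
  have hd0 : d 0 = 1 := by
    have := lel_y; rw [hd] at this; simpa [ytr, y00] using this
  obtain ⟨M', hM'⟩ := yh_supp lel y00
  have hdb : ∀ i, M' < |i| → d i = 0 := by
    intro i hi
    have := hM' i hi
    rw [hd] at this
    simpa [ytr, y00] using this
  let q := Nat.card F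
  have hq : 0 < q := Nat.card_pos
  obtain ⟨n, hn⟩ : ∃ n : ℕ, M < n ∧ M' < n := ⟨(max M M').toNat + 1, by lia, by lia⟩
  let w : WW := (tel ^ (q * n))⁻¹ * lel * tel ^ (q * n) * lel⁻¹
  have hw1 := conj_y (q * n) d hd
  have hψ : ψ (tel ^ (q * n)) = 1 := by
    rw [map_pow, pow_mul, pow_card_eq_one', one_pow]
  have hwm : w ∈ Wp ⊓ N0 ⊓ ψ.ker := by
    refine ⟨⟨?_, ?_⟩, ?_⟩
    · exact Wp.mul_mem (Wp.mul_mem (Wp.mul_mem (Wp.inv_mem (Wp.pow_mem tel_mem _)) lel_mem)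
        (Wp.pow_mem tel_mem _)) (Wp.inv_mem lel_mem)
    · refine N0.mul_mem ?_ (N0.inv_mem lel_th)
      rw [mem_N0]
      have h1 := congrArg Prod.fst hw1
      rw [yh_fst] at h1
      · simpa [ytr, y00] using h1
      · exact (Wp.mul_mem (Wp.mul_mem (Wp.inv_mem (Wp.pow_mem tel_mem _)) lel_mem)
          (Wp.pow_mem tel_mem _))
    · show ψ w = 1
      simp [w, map_mul, map_inv, hψ]
  obtain ⟨e, he, he'⟩ := hle hwm
  have hw2 : yh w y00 = ytr 0 (fun i => d (i - 2 * ((q * n : ℕ) : ℤ)) + d i) y00 := by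
    have : yh lel⁻¹ y00 = ytr 0 d y00 := by
      rw [map_inv, Equiv.Perm.inv_eq_iff_eq, yh_tr, hd]; simp [ytr, y00, CharTwo.add_self_eq_zero]
    show yh (_ * lel⁻¹) y00 = _
    rw [map_mul, Equiv.Perm.mul_apply, this, yh_tr, hw1]
    ext i <;> simp [ytr, y00]
  have h3 : e (2 * ((q * n : ℕ) : ℤ)) = 1 := by
    rw [hw2] at he
    have := congrFun (congrArg Prod.snd he) (2 * ((q * n : ℕ) : ℤ))
    simp [ytr, y00, hd0] at this
    push_cast
    rw [← this, hdb]
    · simp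
    · have : (n : ℤ) ≤ q * n := by nlinarith
      rw [abs_of_nonneg (by positivity)]; lia
  rw [he'] at h3
  · simp at h3
  · push_cast
    have : (n : ℤ) ≤ q * n := by nlinarith
    rw [abs_of_nonneg (by positivity)]; lia

end Cocycle
end Paper

namespace Paper
section Geometry
open Matrix

/-- `ℤ[φ]` -/
abbrev RR := QuadraticAlgebra ℤ 1 1

/-- golden ratio -/
def ph : RR := ⟨0, 1⟩

/-- roots -/
def ev : Fin 12 → Fin 5 → RR
  | 0 => ![0, 1, ph, 1, 0] | 1 => ![1, ph, 0, 1, 0] | 2 => ![ph, 0, 1, 1, 0]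
  | 3 => ![0, 1, -ph, 1, 0] | 4 => ![1, -ph, 0, 1, 0] | 5 => ![-ph, 0, 1, 1, 0]
  | 6 => ![0, -1, ph, 1, 0] | 7 => ![-1, ph, 0, 1, 0] | 8 => ![ph, 0, -1, 1, 0]
  | 9 => ![0, -1, -ph, 1, 0] | 10 => ![-1, -ph, 0, 1, 0] | 11 => ![-ph, 0, -1, 1, 0]

/-- the form (doubled) -/
def bf {S : Type*} [CommRing S] (p : S) (x y : Fin 5 → S) : S :=
  x 0 * y 0 + x 1 * y 1 + x 2 * y 2 - p * (x 3 * y 3) + 2 * (x 4 * y 4)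

/-- diagonal of the form -/
def gd {S : Type*} [CommRing S] (p : S) : Fin 5 → S := ![1, 1, 1, -p, 2]

/-- reflection matrix -/
def Rm {S : Type*} [CommRing S] (p : S) (e : Fin 5 → S) : Matrix (Fin 5) (Fin 5) S :=
  Matrix.of fun i k => (if i = k then 1 else 0) - e i * (gd p k * e k)

theorem Rm_mulVec {S : Type*} [CommRing S] (p : S) (e x : Fin 5 → S) :
    Rm p e *ᵥ x = x - bf p x e • e := by
  ext i
  fin_cases i <;> simp [Rm, Matrix.mulVec, dotProduct, Fin.sum_univ_five, gd, bf] <;> ring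

theorem bf_refl {S : Type*} [CommRing S] (p : S) (e x y : Fin 5 → S) (he : bf p e e = 2) :
    bf p (x - bf p x e • e) (y - bf p y e • e) = bf p x y := by
  have : bf p (x - bf p x e • e) (y - bf p y e • e) =
    bf p x y - 2 * (bf p x e * bf p y e) + bf p x e * bf p y e * bf p e e := by
    unfold bf; simp only [Pi.sub_apply, Pi.smul_apply, smul_eq_mul]; ring
  rw [this, he]; ring

theorem bf_comm {S : Type*} [CommRing S] (p : S) (x y : Fin 5 → S) : bf p x y = bf p y x := by
  unfold bf; ring

theorem mat_ext {S : Type*} [CommRing S] {A B : Matrix (Fin 5) (Fin 5) S}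
    (h : ∀ x, A *ᵥ x = B *ᵥ x) : A = B := by
  ext i k
  have := congrFun (h (Pi.single k 1)) i
  simpa using this

theorem ev_form : ∀ s t : Fin 12, bf ph (ev s) (ev t) =
    if s = t then 2 else if iadj s t = true then 0 else
      if bf ph (ev s) (ev t) = ⟨0, -2⟩ then ⟨0, -2⟩ else ⟨-2, -2⟩ := by
  decide +kernel

theorem ev_self (s) : bf ph (ev s) (ev s) = 2 := by rw [ev_form]; simp
theorem iadj_ne : ∀ s t, iadj s t = true → s ≠ t := by decide +kernel
theorem ev_adj (s t) (h : iadj s t = true) : bf ph (ev s) (ev t) = 0 := by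
  rw [ev_form]; simp [h, iadj_ne s t h]
theorem ev3 : ∀ s, ev s 3 = 1 := by decide +kernel
theorem ev4 : ∀ s, ev s 4 = 0 := by decide +kernel

theorem Rm_sq {S : Type*} [CommRing S] (p : S) (e : Fin 5 → S) (he : bf p e e = 2) :
    Rm p e * Rm p e = 1 := by
  apply mat_ext; intro x
  rw [← mulVec_mulVec, Rm_mulVec, Rm_mulVec, one_mulVec]
  have : bf p (x - bf p x e • e) e = - bf p x e := by
    have : bf p (x - bf p x e • e) e = bf p x e - bf p x e * bf p e e := by
      unfold bf; simp only [Pi.sub_apply, Pi.smul_apply, smul_eq_mul]; ring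
    rw [this, he]; ring
  rw [this]; simp

theorem Rm_comm {S : Type*} [CommRing S] (p : S) (e f : Fin 5 → S) (he : bf p e f = 0) :
    Rm p e * Rm p f = Rm p f * Rm p e := by
  apply mat_ext; intro x
  simp only [← mulVec_mulVec, Rm_mulVec]
  have h : ∀ e f : Fin 5 → S, bf p e f = 0 → bf p (x - bf p x f • f) e = bf p x e := by
    intro e f he
    have : bf p (x - bf p x f • f) e = bf p x e - bf p x f * bf p e f := by
      unfold bf; simp only [Pi.sub_apply, Pi.smul_apply, smul_eq_mul]; ring
    rw [this, he]; ring
  rw [h e f he, h f e (by rw [bf_comm]; exact he)]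
  abel

/-- the representation -/
def rh : WW →* GL (Fin 5) RR :=
  whom (fun s => ⟨Rm ph (ev s), Rm ph (ev s), Rm_sq _ _ (ev_self s), Rm_sq _ _ (ev_self s)⟩)
    (fun s => Units.ext (Rm_sq _ _ (ev_self s)))
    (fun s t h => Units.ext (Rm_comm _ _ _ (ev_adj s t h)))

theorem rh_sg (s) : ((rh (sg s) : GL (Fin 5) RR) : Matrix (Fin 5) (Fin 5) RR) = Rm ph (ev s) := by
  unfold rh; rw [whom_sg]

variable {S : Type*} [CommRing S] (j : RR →+* S)

/-- action over `S` -/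
def aj (w : WW) (x : Fin 5 → S) : Fin 5 → S := ((rh w : Matrix (Fin 5) (Fin 5) RR).map j) *ᵥ x

theorem aj_mul (w v x) : aj j (w * v) x = aj j w (aj j v x) := by
  unfold aj; rw [map_mul, Units.val_mul, Matrix.map_mul, mulVec_mulVec]

theorem aj_one (x) : aj j 1 x = x := by
  unfold aj; rw [map_one, Units.val_one, Matrix.map_one _ (map_zero j) (map_one j), one_mulVec]

theorem aj_inv (w x) : aj j w⁻¹ (aj j w x) = x := by rw [← aj_mul, inv_mul_cancel, aj_one]

theorem aj_inv' (w x) : aj j w (aj j w⁻¹ x) = x := by rw [← aj_mul, mul_inv_cancel, aj_one]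

theorem j_two : j 2 = 2 := map_ofNat j 2

theorem Rm_map (p : RR) (e : Fin 5 → RR) : (Rm p e).map j = Rm (j p) (j ∘ e) := by
  ext i k
  have : j (gd p k) = gd (j p) k := by
    fin_cases k <;> simp [gd, j_two]
  simp [Rm, this, apply_ite j]

theorem bf_map (p : RR) (x y : Fin 5 → RR) : j (bf p x y) = bf (j p) (j ∘ x) (j ∘ y) := by
  simp [bf, j_two]

theorem aj_sg (s x) : aj j (sg s) x = x - bf (j ph) x (j ∘ ev s) • (j ∘ ev s) := by
  unfold aj; rw [rh_sg, Rm_map, Rm_mulVec]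

theorem aj_smul (w) (c : S) (x) : aj j w (c • x) = c • aj j w x := by
  unfold aj; rw [mulVec_smul]
theorem aj_add (w) (x y : Fin 5 → S) : aj j w (x + y) = aj j w x + aj j w y := by
  unfold aj; rw [mulVec_add]
theorem aj_sub (w) (x y : Fin 5 → S) : aj j w (x - y) = aj j w x - aj j w y := by
  unfold aj; rw [mulVec_sub]

theorem evj_self (s) : bf (j ph) (j ∘ ev s) (j ∘ ev s) = 2 := by
  rw [← bf_map, ev_self, map_ofNat]

theorem aj_form (w x y) : bf (j ph) (aj j w x) (aj j w y) = bf (j ph) x y := by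
  induction w using ww_induction with
  | h1 => simp [aj_one]
  | h2 s w ih =>
    rw [aj_mul, aj_mul, aj_sg, aj_sg, bf_refl _ _ _ _ (evj_self j s), ih]

theorem aj_comp {T : Type*} [CommRing T] (f : S →+* T) (w x) :
    aj (f.comp j) w (f ∘ x) = f ∘ (aj j w x) := by
  unfold aj
  ext i
  simp [Matrix.mulVec, dotProduct, map_sum]

theorem aj_id_comp (w) (x : Fin 5 → RR) : aj j w (j ∘ x) = j ∘ (aj (RingHom.id RR) w x) :=
  aj_comp (RingHom.id RR) j w x

theorem aj_e4 (w) : aj j w (Pi.single 4 1) = Pi.single 4 1 := by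
  induction w using ww_induction with
  | h1 => simp [aj_one]
  | h2 s w ih =>
    rw [aj_mul, ih, aj_sg]
    have : bf (j ph) (Pi.single 4 1) (j ∘ ev s) = 0 := by
      simp [bf, ev4]
    rw [this]; simp

/-- golden ratio hom -/
noncomputable def jr : RR →+* ℝ := (QuadraticAlgebra.lift ⟨Real.goldenRatio, by
  have := Real.goldenRatio_sq; simp; linarith [this, sq Real.goldenRatio]⟩ : RR →ₐ[ℤ] ℝ).toRingHom

/-- conjugate hom -/
noncomputable def jc : RR →+* ℝ := (QuadraticAlgebra.lift ⟨Real.goldenConj, by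
  have := Real.goldenConj_sq; simp; linarith [this, sq Real.goldenConj]⟩ : RR →ₐ[ℤ] ℝ).toRingHom

theorem jr_apply (z : RR) : jr z = z.re + z.im * Real.goldenRatio := by
  simp [jr, QuadraticAlgebra.lift]
theorem jc_apply (z : RR) : jc z = z.re + z.im * Real.goldenConj := by
  simp [jc, QuadraticAlgebra.lift]
theorem jr_ph : jr ph = Real.goldenRatio := by rw [jr_apply]; simp [ph]
theorem jc_ph : jc ph = Real.goldenConj := by rw [jc_apply]; simp [ph]

end Geometry
end Paper

namespace Paper
section Racg
open Matrix

/-- word product -/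
def prw (l : List (Fin 12)) : WW := (l.map sg).prod

theorem prw_cons (s l) : prw (s :: l) = sg s * prw l := by simp [prw]

/-- coset length -/
noncomputable def Lw (w : WW) : ℕ :=
  sInf {n | ∃ l : List (Fin 12), l.length = n ∧ (prw l = w ∨ prw l = w * sg 5)}

theorem Lw_le (l : List (Fin 12)) (w : WW) (h : prw l = w ∨ prw l = w * sg 5) : Lw w ≤ l.length :=
  Nat.sInf_le ⟨l, rfl, h⟩

theorem Lw_ex (w : WW) : ∃ l : List (Fin 12), l.length = Lw w ∧ (prw l = w ∨ prw l = w * sg 5) := by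
  have : ∃ l : List (Fin 12), prw l = w := by
    induction w using ww_induction with
    | h1 => exact ⟨[], rfl⟩
    | h2 s w ih => obtain ⟨l, rfl⟩ := ih; exact ⟨s :: l, prw_cons _ _⟩
  obtain ⟨l, hl⟩ := this
  exact Nat.sInf_mem (s := {n | ∃ l : List (Fin 12), l.length = n ∧ (prw l = w ∨ prw l = w * sg 5)})
    ⟨_, l, rfl, Or.inl hl⟩

theorem Lw_v (w : WW) : Lw (w * sg 5) = Lw w := by
  have h : ∀ w, Lw (w * sg 5) ≤ Lw w := by
    intro w
    obtain ⟨l, h1, h2⟩ := Lw_ex w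
    rw [← h1]
    apply Lw_le
    rcases h2 with h | h
    · right; rw [h, mul_assoc, sg_sq, mul_one]
    · left; exact h
  apply le_antisymm (h w)
  have := h (w * sg 5)
  rwa [mul_assoc, sg_sq, mul_one] at this

theorem Lw_sg (s w) : Lw (sg s * w) ≤ Lw w + 1 := by
  obtain ⟨l, h1, h2⟩ := Lw_ex w
  rw [← h1]
  apply Lw_le (s :: l)
  rw [prw_cons, mul_assoc]
  rcases h2 with h | h <;> simp [h]

theorem Lw_zero (w) (h : Lw w = 0) : w = 1 ∨ w = sg 5 := by
  obtain ⟨l, h1, h2⟩ := Lw_ex w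
  rw [h, List.length_eq_zero_iff] at h1
  subst h1
  rcases h2 with h | h
  · left; rw [← h]; rfl
  · right
    have h' : w * sg 5 = 1 := by rw [← h]; rfl
    rw [eq_comm, ← sg_inv]; exact inv_eq_of_mul_eq_one_left h'

theorem Lw_succ (w n) (h : Lw w = n + 1) : ∃ s w', Lw w' = n ∧ (w = sg s * w' ∨ w = sg s * w' * sg 5) := by
  obtain ⟨l, h1, h2⟩ := Lw_ex w
  rw [h] at h1
  cases l with
  | nil => simp at h1
  | cons s l =>
    rw [prw_cons] at h2
    have h3 : w = sg s * prw l ∨ w = sg s * prw l * sg 5 := by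
      rcases h2 with h | h
      · left; exact h.symm
      · right; rw [h, mul_assoc, sg_sq, mul_one]
    refine ⟨s, prw l, le_antisymm ?_ ?_, h3⟩
    · have := Lw_le l (prw l) (Or.inl rfl); simp at h1; lia
    · have := Lw_sg s (prw l)
      have h4 : Lw w = Lw (sg s * prw l) := by
        rcases h3 with h | h
        · rw [← h]
        · rw [h, Lw_v]
      lia

/-- real golden ratio -/
local notation "Φ" => Real.goldenRatio

/-- real roots -/
noncomputable def er (s : Fin 12) : Fin 5 → ℝ := jr ∘ ev s
/-- real form -/
noncomputable def bb (x y : Fin 5 → ℝ) : ℝ := bf Φ x y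
/-- real action -/
noncomputable def ar (w : WW) (x : Fin 5 → ℝ) : Fin 5 → ℝ := aj jr w x

theorem ar_mul (w v x) : ar (w * v) x = ar w (ar v x) := aj_mul _ _ _ _
theorem ar_one (x) : ar 1 x = x := aj_one _ _
theorem ar_sg (s x) : ar (sg s) x = x - bb x (er s) • er s := by
  unfold ar bb er; rw [aj_sg, jr_ph]
theorem ar_form (w x y) : bb (ar w x) (ar w y) = bb x y := by
  have := aj_form jr w x y
  rw [jr_ph] at this; exact this
theorem er_map (s t) : bb (er s) (er t) = jr (bf ph (ev s) (ev t)) := by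
  rw [bf_map, jr_ph]; rfl
theorem er_self (s) : bb (er s) (er s) = 2 := by rw [er_map, ev_self]; exact j_two _
theorem er_adj (s t) (h : iadj s t = true) : bb (er s) (er t) = 0 := by rw [er_map, ev_adj s t h]; simp
theorem er_non (s t) (h : iadj s t = false) (hst : s ≠ t) : bb (er s) (er t) ≤ -2 * Φ := by
  rw [er_map, ev_form]
  have := Real.one_lt_goldenRatio
  simp only [hst, if_false, h, Bool.false_eq_true]
  split_ifs
  · rw [jr_apply]; simp
  · rw [jr_apply]; simp
theorem er3 (s) : er s 3 = 1 := by simp [er, ev3]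
theorem er4 (s) : er s 4 = 0 := by simp [er, ev4]

theorem bb_comm (x y) : bb x y = bb y x := bf_comm _ _ _

theorem bb_lin (x y z) (c : ℝ) : bb (x + c • y) z = bb x z + c * bb y z := by
  unfold bb bf; simp only [Pi.add_apply, Pi.smul_apply, smul_eq_mul]; ring

/-- future timelike -/
def Fu (x : Fin 5 → ℝ) : Prop := bb x x < 0 ∧ 0 < x 3

theorem Fu_neg {x y} (hx : Fu x) (hy : bb y y ≤ 0) (hy3 : 0 < y 3) : bb x y < 0 := by
  obtain ⟨h1, h2⟩ := hx
  have key : 0 ≤ (y 3)^2 * bb x x - 2 * (x 3 * y 3) * bb x y + (x 3)^2 * bb y y := by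
    have : (y 3)^2 * bb x x - 2 * (x 3 * y 3) * bb x y + (x 3)^2 * bb y y =
      (y 3 * x 0 - x 3 * y 0)^2 + (y 3 * x 1 - x 3 * y 1)^2 + (y 3 * x 2 - x 3 * y 2)^2 +
        2 * (y 3 * x 4 - x 3 * y 4)^2 := by
      unfold bb bf; ring
    rw [this]; positivity
  by_contra hc
  push Not at hc
  have : (y 3)^2 * bb x x < 0 := mul_neg_of_pos_of_neg (by positivity) h1
  have h3 : (x 3)^2 * bb y y ≤ 0 := mul_nonpos_of_nonneg_of_nonpos (by positivity) hy
  have h4 : 0 ≤ 2 * (x 3 * y 3) * bb x y := by positivity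
  linarith

theorem bf_T (p : ℝ) (y : Fin 5 → ℝ) : bf p (Pi.single 3 1 + p • y) (Pi.single 3 1 + p • y) =
    -p - 2 * p^2 * y 3 + p^2 * bf p y y := by
  unfold bf; simp; ring

theorem Fu_sg {x} (hx : Fu x) (s) : Fu (ar (sg s) x) := by
  have hp := Real.goldenRatio_pos
  refine ⟨by rw [ar_form]; exact hx.1, ?_⟩
  have h := Fu_neg hx (y := Pi.single 3 1 + Φ • er s) (by
      have : bb (Pi.single 3 1 + Φ • er s) (Pi.single 3 1 + Φ • er s) = -Φ - 2 * Φ^2 * er s 3 + Φ^2 * bb (er s) (er s) := by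
        exact bf_T Φ (er s)
      rw [this, er3, er_self]; linarith) (by simp [er3]; linarith)
  have h2 : bb x (Pi.single 3 1 + Φ • er s) = -Φ * (ar (sg s) x) 3 := by
    rw [ar_sg]
    simp only [Pi.sub_apply, Pi.smul_apply, er3, smul_eq_mul]
    unfold bb bf; simp [er3]; ring
  rw [h2] at h
  nlinarith

theorem Fu_ar {x} (hx : Fu x) (w) : Fu (ar w x) := by
  induction w using ww_induction with
  | h1 => rwa [ar_one]
  | h2 s w ih => rw [ar_mul]; exact Fu_sg ih s

theorem Fu_non {x} (hx : Fu x) (s t) (h : iadj s t = false) (hst : s ≠ t)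
    (h1 : 0 ≤ bb x (er s)) (h2 : 0 ≤ bb x (er t)) : False := by
  have hp := Real.one_lt_goldenRatio
  have h3 := Fu_neg hx (y := er s + er t) (by
    have : bb (er s + er t) (er s + er t) = bb (er s) (er s) + bb (er t) (er t) + 2 * bb (er s) (er t) := by
      unfold bb bf; simp only [Pi.add_apply]; ring
    rw [this, er_self, er_self]
    have := er_non s t h hst
    linarith) (by simp [er3])
  have : bb x (er s + er t) = bb x (er s) + bb x (er t) := by
    unfold bb bf; simp only [Pi.add_apply]; ring
  linarith

/-- base point -/
noncomputable def xb : Fin 5 → ℝ := Pi.single 3 1 + (Φ / 2) • er 5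

theorem xb_form (s) : bb xb (er s) = -Φ + Φ / 2 * bb (er 5) (er s) := by
  unfold xb; rw [bb_lin]; congr 1
  unfold bb bf; simp [er3]

theorem xb_5 : bb xb (er 5) = 0 := by rw [xb_form, er_self]; ring

theorem xb_neg (s) (hs : s ≠ 5) : bb xb (er s) < 0 := by
  have hp := Real.goldenRatio_pos
  rw [xb_form]
  have : bb (er 5) (er s) ≤ 0 := by
    cases h : iadj 5 s
    · have := er_non 5 s h hs.symm; linarith
    · rw [er_adj _ _ h]
  nlinarith

theorem xb_le (s) : bb xb (er s) ≤ 0 := by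
  by_cases h : s = 5
  · rw [h, xb_5]
  · exact (xb_neg s h).le

theorem Fu_xb : Fu xb := by
  have hp := Real.goldenRatio_pos
  constructor
  · have : bb xb xb = bb xb (Pi.single 3 1) + Φ / 2 * bb xb (er 5) := by
      conv_lhs => rw [show bb xb xb = bb xb (Pi.single 3 1 + (Φ / 2) • er 5) from rfl]
      rw [bb_comm, bb_lin, bb_comm, bb_comm (er 5)]
    rw [this, xb_5]
    have h2 : bb xb (Pi.single 3 1) = -Φ * (1 + Φ / 2) := by
      unfold bb bf xb; simp [er3]
    rw [h2]; nlinarith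
  · simp [xb, er3]; linarith

theorem ar5_xb : ar (sg 5) xb = xb := by rw [ar_sg, xb_5]; simp

theorem bb_sg_adj (w : WW) (s t) (x) (h : iadj s t = true) :
    bb (ar (sg s * w) x) (er t) = bb (ar w x) (er t) := by
  rw [ar_mul]
  have : er t = ar (sg s) (er t) := by
    rw [ar_sg, bb_comm, er_adj _ _ h]; simp
  conv_lhs => rw [this]
  rw [ar_form]

theorem bb_sg_self (s) (x) : bb (ar (sg s) x) (er s) = - bb x (er s) := by
  have : ar (sg s) (er s) = - er s := by
    rw [ar_sg, er_self]; ext i; simp; ring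
  have h := ar_form (sg s) x (er s)
  rw [this] at h
  rw [← h]; unfold bb bf; simp; ring

theorem ar_v (w : WW) : ar (w * sg 5) xb = ar w xb := by rw [ar_mul, ar5_xb]

/-- the key property -/
def AA (w : WW) : Prop := ∀ t, 0 ≤ bb (ar w xb) (er t) → Lw (sg t * w) < Lw w ∨ sg t * w = w * sg 5

theorem AA_P (w : WW) (h : AA w) (s) (hs : Lw (sg s * w) = Lw w + 1) : 0 < bb (ar (sg s * w) xb) (er s) := by
  rw [ar_mul, bb_sg_self]
  by_contra hc
  rcases h s (by linarith) with h | h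
  · lia
  · rw [h, Lw_v] at hs; lia

theorem AA_all (n : ℕ) : ∀ w, Lw w = n → AA w := by
  induction n with
  | zero =>
    intro w hw t ht
    have h5 : ar w xb = xb := by
      rcases Lw_zero w hw with rfl | rfl
      · rw [ar_one]
      · exact ar5_xb
    rw [h5] at ht
    have ht5 : t = 5 := by
      by_contra h; have := xb_neg t h; linarith
    right
    subst ht5
    rcases Lw_zero w hw with rfl | rfl <;> simp
  | succ n ih =>
    have main : ∀ s w', Lw w' = n → Lw (sg s * w') = n + 1 → AA (sg s * w') := by
      intro s w' hw' hw t ht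
      have hP := AA_P w' (ih w' hw') s (by lia)
      by_cases hst : s = t
      · subst hst
        left; rw [sg_cancel]; lia
      cases hadj : iadj s t
      · exact (Fu_non (Fu_ar Fu_xb _) s t hadj hst hP.le ht).elim
      · rw [bb_sg_adj _ _ _ _ hadj] at ht
        have hc : sg t * (sg s * w') = sg s * (sg t * w') := by
          rw [← mul_assoc, ← sg_comm s t hadj, mul_assoc]
        rcases ih w' hw' t ht with h | h
        · left; rw [hc]; have := Lw_sg s (sg t * w'); lia
        · right; rw [hc, h, mul_assoc]
    intro w hw
    obtain ⟨s, w', hw', h | h⟩ := Lw_succ w n hw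
    · rw [h]; exact main s w' hw' (by rw [← h]; exact hw)
    · have h1 := main s w' hw' (by rw [← Lw_v, ← h]; exact hw)
      intro t ht
      rw [h, ar_v] at ht
      rcases h1 t ht with h2 | h2
      · left; rw [h, ← mul_assoc, Lw_v, Lw_v]; exact h2
      · right; rw [h, ← mul_assoc, h2]

theorem pos_first (w : WW) (h : Lw w ≠ 0) : ∃ s, Lw (sg s * w) < Lw w ∧ 0 < bb (ar w xb) (er s) := by
  obtain ⟨n, hn⟩ := Nat.exists_eq_succ_of_ne_zero h
  obtain ⟨s, w', hw', hh⟩ := Lw_succ w n hn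
  have hl : Lw (sg s * w') = n + 1 := by
    rcases hh with h | h
    · rw [← h]; exact hn
    · rw [← Lw_v, ← h]; exact hn
  have hP := AA_P w' (AA_all n w' hw') s (by lia)
  refine ⟨s, ?_, ?_⟩
  · rcases hh with h | h
    · rw [h, sg_cancel, hw', hl]; lia
    · rw [h, mul_assoc, sg_cancel, Lw_v, ← mul_assoc, Lw_v]; lia
  · rcases hh with h | h
    · rw [h]; exact hP
    · rw [h, ar_v]; exact hP

theorem er5_ne : er 5 ≠ - er 5 := by
  intro h; have := congrFun h 3; simp [er3] at this; linarith

theorem ar5_er5 : ar (sg 5) (er 5) = - er 5 := by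
  rw [ar_sg, er_self]; ext i; simp; ring

theorem rh_inj (w : WW) (h : ∀ x, ar w x = x) : w = 1 := by
  by_cases h0 : Lw w = 0
  · rcases Lw_zero w h0 with h1 | h1
    · exact h1
    · exfalso
      have := h (er 5)
      rw [h1, ar5_er5] at this
      exact er5_ne this.symm
  · obtain ⟨s, _, h2⟩ := pos_first w h0
    rw [h] at h2
    have := xb_le s; linarith

/-- elements of the star subgroup -/
def Sst : Subgroup WW := Subgroup.closure (sg '' {s | s = 5 ∨ iadj 5 s = true})

theorem ar_neg (w x) : ar w (-x) = - ar w x := by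
  have := aj_smul jr w (-1) x; simpa [ar] using this

theorem ar_pent (s) (h : iadj 5 s = true) : ar (sg s) (er 5) = er 5 := by
  rw [ar_sg, er_adj _ _ h]; simp

theorem stab (w : WW) (h : ar w (er 5) = er 5) : w ∈ Wp := by
  -- choose minimal representative
  have hex : ∃ n, ∃ c ∈ Sst, Lw (c * w) = n := ⟨_, 1, Sst.one_mem, rfl⟩
  classical
  obtain ⟨c, hc, hcl⟩ := Nat.find_spec hex
  have hmin : ∀ d ∈ Sst, Lw (c * w) ≤ Lw (d * w) := by
    intro d hd; rw [hcl]; exact Nat.find_min' hex ⟨d, hd, rfl⟩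
  have hpm : ∀ d ∈ Sst, ar d (er 5) = er 5 ∨ ar d (er 5) = - er 5 := by
    intro d hd
    unfold Sst at hd
    have step : ∀ s y, (s = 5 ∨ iadj 5 s = true) → (ar y (er 5) = er 5 ∨ ar y (er 5) = - er 5) →
        (ar (sg s * y) (er 5) = er 5 ∨ ar (sg s * y) (er 5) = - er 5) := by
      intro s y hs hy
      have h1 : ar (sg s) (er 5) = er 5 ∨ ar (sg s) (er 5) = - er 5 := by
        rcases hs with rfl | hs
        · right; exact ar5_er5
        · left; exact ar_pent s hs
      rw [ar_mul]
      rcases hy with hy | hy <;> rw [hy]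
      · exact h1
      · rw [ar_neg]
        rcases h1 with h1 | h1 <;> rw [h1] <;> simp
    induction hd using Subgroup.closure_induction_left with
    | one => left; exact ar_one _
    | mul_left x hx y hy ih =>
      obtain ⟨s, hs, rfl⟩ := hx; exact step s y hs ih
    | inv_mul_cancel x hx y hy ih =>
      obtain ⟨s, hs, rfl⟩ := hx; rw [sg_inv]; exact step s y hs ih
  have h0 : bb (ar (c * w) xb) (er 5) = 0 := by
    have h1 := ar_form (c * w) xb (er 5)
    rw [xb_5, ar_mul c w (er 5), h] at h1
    rcases hpm c hc with h2 | h2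
    · rwa [h2] at h1
    · rw [h2] at h1
      have : bb (ar (c * w) xb) (- er 5) = - bb (ar (c * w) xb) (er 5) := by
        unfold bb bf; simp; ring
      linarith
  have hL : Lw (c * w) = 0 := by
    by_contra hne
    obtain ⟨s, h2, h3⟩ := pos_first _ hne
    by_cases hs5 : s = 5
    · subst hs5; linarith
    cases hadj : iadj 5 s
    · exact Fu_non (Fu_ar Fu_xb (c * w)) 5 s hadj (Ne.symm hs5) h0.ge h3.le
    · have := hmin (sg s * c) (Sst.mul_mem (Subgroup.subset_closure ⟨s, Or.inr hadj, rfl⟩) hc)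
      rw [mul_assoc] at this; lia
  have hv : sg 5 ∈ Sst := Subgroup.subset_closure ⟨5, Or.inl rfl, rfl⟩
  have hw : w ∈ Sst := by
    have : c * w ∈ Sst := by
      rcases Lw_zero _ hL with h | h <;> rw [h]
      · exact Sst.one_mem
      · exact hv
    exact (Subgroup.mul_mem_cancel_left _ hc).1 this
  have hdec : ∀ d ∈ Sst, d ∈ Wp ∨ sg 5 * d ∈ Wp := by
    intro d hd
    unfold Sst at hd
    have step : ∀ s y, (s = 5 ∨ iadj 5 s = true) → (y ∈ Wp ∨ sg 5 * y ∈ Wp) →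
        (sg s * y ∈ Wp ∨ sg 5 * (sg s * y) ∈ Wp) := by
      intro s y hs hy
      rcases hs with rfl | hs
      · rw [sg_cancel]; exact hy.symm
      · have := sgp s hs
        rcases hy with hy | hy
        · left; exact Wp.mul_mem this hy
        · right
          rw [← mul_assoc, sg_comm 5 s hs, mul_assoc]; exact Wp.mul_mem this hy
    induction hd using Subgroup.closure_induction_left with
    | one => left; exact Wp.one_mem
    | mul_left x hx y hy ih =>
      obtain ⟨s, hs, rfl⟩ := hx; exact step s y hs ih
    | inv_mul_cancel x hx y hy ih =>
      obtain ⟨s, hs, rfl⟩ := hx; rw [sg_inv]; exact step s y hs ih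
  have hfix : ∀ d ∈ Wp, ar d (er 5) = er 5 := by
    intro d hd
    unfold Wp at hd
    induction hd using Subgroup.closure_induction_left with
    | one => exact ar_one _
    | mul_left x hx y hy ih =>
      obtain ⟨s, hs, rfl⟩ := hx; rw [ar_mul, ih, ar_pent s hs]
    | inv_mul_cancel x hx y hy ih =>
      obtain ⟨s, hs, rfl⟩ := hx; rw [sg_inv, ar_mul, ih, ar_pent s hs]
  rcases hdec w hw with h1 | h1
  · exact h1
  · have := hfix _ h1
    rw [ar_mul, h, ar5_er5] at this
    exact absurd this.symm er5_ne

theorem Wp_fix (d : WW) (hd : d ∈ Wp) : ar d (er 5) = er 5 := by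
  unfold Wp at hd
  induction hd using Subgroup.closure_induction_left with
  | one => exact ar_one _
  | mul_left x hx y hy ih =>
    obtain ⟨s, hs, rfl⟩ := hx; rw [ar_mul, ih, ar_pent s hs]
  | inv_mul_cancel x hx y hy ih =>
    obtain ⟨s, hs, rfl⟩ := hx; rw [sg_inv, ar_mul, ih, ar_pent s hs]

end Racg
end Paper

namespace Paper
section PingPong
open Matrix

/-- the finite ring -/
abbrev Rf := QuadraticAlgebra (ZMod 160) 1 1

instance : Finite Rf := Finite.of_equiv _ (QuadraticAlgebra.equivProd (R := ZMod 160) 1 1).symm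

/-- reduction -/
def rd : RR →+* Rf := (QuadraticAlgebra.lift ⟨⟨0, 1⟩, by ext <;> simp <;> rfl⟩ : RR →ₐ[ℤ] Rf).toRingHom

theorem rd_apply (z : RR) : rd z = ⟨z.re, z.im⟩ := by
  ext <;> simp [rd, QuadraticAlgebra.lift]

theorem rd_eq (z y : RR) (h : rd z = rd y) : ∃ t : RR, z = y + 160 * t := by
  rw [rd_apply, rd_apply] at h
  have h1 : (z.re : ZMod 160) = y.re := congrArg QuadraticAlgebra.re h
  have h2 : (z.im : ZMod 160) = y.im := congrArg QuadraticAlgebra.im h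
  rw [ZMod.intCast_eq_intCast_iff_dvd_sub] at h1 h2
  obtain ⟨a, ha⟩ := h1
  obtain ⟨b, hb⟩ := h2
  refine ⟨⟨-a, -b⟩, ?_⟩
  have : (160 : RR) = ⟨160, 0⟩ := rfl
  rw [this]
  ext <;> simp <;> push_cast at * <;> omega

/-- congruence hom -/
def ps : WW →* GL (Fin 5) Rf := (Matrix.GeneralLinearGroup.map rd).comp rh

theorem ps_ker (w : WW) (h : w ∈ ps.ker) : ∃ Z : Matrix (Fin 5) (Fin 5) RR,
    (rh w : Matrix (Fin 5) (Fin 5) RR) = 1 + (160 : RR) • Z := by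
  have h1 : ∀ i k, rd ((rh w : Matrix (Fin 5) (Fin 5) RR) i k) = rd ((1 : Matrix (Fin 5) (Fin 5) RR) i k) := by
    intro i k
    have := congrArg (fun g : GL (Fin 5) Rf => (g : Matrix (Fin 5) (Fin 5) Rf) i k) (MonoidHom.mem_ker.1 h)
    simp only [ps, MonoidHom.comp_apply, Matrix.GeneralLinearGroup.map_apply, Units.val_one] at this
    rw [this]
    by_cases hik : i = k
    · subst hik; simp
    · simp [hik]
  choose Z hZ using fun i k => rd_eq _ _ (h1 i k)
  refine ⟨Matrix.of Z, ?_⟩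
  ext1 i k
  rw [hZ]; simp

/-- the subgroup -/
def NW : Subgroup WW := N0 ⊓ ps.ker

theorem NW_fg : NW.FG := by
  have : Group.FG N0 := (Group.fg_iff_subgroup_fg N0).2 N0_fg
  have : (ps.comp N0.subtype).ker.FiniteIndex := inferInstance
  have h := Subgroup.fg_of_index_ne_zero (ps.comp N0.subtype).ker
  have h2 := fg_map' N0.subtype ((Group.fg_iff_subgroup_fg _).1 h)
  have : (ps.comp N0.subtype).ker.map N0.subtype = NW := by
    ext w
    simp only [Subgroup.mem_map, MonoidHom.mem_ker, NW, Subgroup.mem_inf]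
    constructor
    · rintro ⟨x, hx, rfl⟩; exact ⟨x.2, hx⟩
    · rintro ⟨h1, h2⟩; exact ⟨⟨w, h1⟩, h2, rfl⟩
  rwa [this] at h2

theorem jc_inj (z : RR) (h : jc z = 0) : z = 0 := by
  rw [jc_apply] at h
  have hi := Real.goldenConj_irrational
  have him : z.im = 0 := by
    by_contra hne
    have := (hi.intCast_mul hne).intCast_add z.re
    rw [h] at this
    exact this.ne_zero rfl
  rw [him] at h
  ext
  · simpa using h
  · simpa using him

/-- conjugate form positive definite -/
theorem bc_nonneg (x : Fin 5 → ℝ) : 0 ≤ bf Real.goldenConj x x := by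
  have := Real.goldenConj_neg
  unfold bf
  nlinarith [mul_self_nonneg (x 0), mul_self_nonneg (x 1), mul_self_nonneg (x 2), mul_self_nonneg (x 4),
    mul_nonneg (mul_self_nonneg (x 3)) (neg_nonneg.2 this.le)]

theorem bc_zero (x : Fin 5 → ℝ) (h : bf Real.goldenConj x x = 0) : x = 0 := by
  have := Real.goldenConj_neg
  have h3' := mul_nonneg (mul_self_nonneg (x 3)) (neg_nonneg.2 this.le)
  have h0' := mul_self_nonneg (x 0)
  have h1' := mul_self_nonneg (x 1)
  have h2' := mul_self_nonneg (x 2)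
  have h4' := mul_self_nonneg (x 4)
  unfold bf at h
  have h0 : x 0 * x 0 = 0 := by nlinarith
  have h1 : x 1 * x 1 = 0 := by nlinarith
  have h2 : x 2 * x 2 = 0 := by nlinarith
  have h4 : x 4 * x 4 = 0 := by nlinarith
  have h3 : (x 3 * x 3) * (- Real.goldenConj) = 0 := by nlinarith
  have h3 : x 3 * x 3 = 0 := by
    rcases mul_eq_zero.1 h3 with h | h
    · exact h
    · linarith
  ext i
  fin_cases i <;> simp_all

theorem bf_sub {S : Type*} [CommRing S] (p : S) (x y : Fin 5 → S) :
    bf p (x - y) (x - y) = bf p x x + bf p y y - 2 * bf p x y := by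
  unfold bf; simp only [Pi.sub_apply]; ring
theorem bf_add {S : Type*} [CommRing S] (p : S) (x y : Fin 5 → S) :
    bf p (x + y) (x + y) = bf p x x + bf p y y + 2 * bf p x y := by
  unfold bf; simp only [Pi.add_apply]; ring

theorem K_large (w : WW) (hw : w ∈ ps.ker) (hne : ar w (er 5) ≠ er 5) :
    6 ≤ |bb (er 5) (ar w (er 5))| := by
  by_contra hlt
  push Not at hlt
  apply hne
  obtain ⟨Z, hZ⟩ := ps_ker w hw
  set f := aj (RingHom.id RR) w (ev 5) with hf
  have hfe : f = ev 5 + (160 : RR) • (Z *ᵥ ev 5) := by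
    rw [hf]; unfold aj
    rw [hZ]
    have : (1 + (160 : RR) • Z).map (RingHom.id RR) = 1 + (160 : RR) • Z := by ext1 i k; rfl
    rw [this, add_mulVec, one_mulVec, smul_mulVec]
  set y := bf ph (ev 5) (Z *ᵥ ev 5) with hy
  have hk : bf ph (ev 5) f = 2 + 160 * y := by
    rw [hfe, hy, ← ev_self 5]
    unfold bf; simp only [Pi.add_apply, Pi.smul_apply, smul_eq_mul]; ring
  have hr : ar w (er 5) = jr ∘ f := aj_id_comp jr w (ev 5)
  have hc : aj jc w (jc ∘ ev 5) = jc ∘ f := aj_id_comp jc w (ev 5)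
  have hkr : bb (er 5) (ar w (er 5)) = 2 + 160 * jr y := by
    have := bf_map jr ph (ev 5) f
    rw [jr_ph, hk] at this
    rw [hr]
    refine this.symm.trans ?_
    simp [map_ofNat]
  have hkc : bf Real.goldenConj (jc ∘ ev 5) (jc ∘ f) = 2 + 160 * jc y := by
    have := bf_map jc ph (ev 5) f
    rw [jc_ph, hk] at this
    refine this.symm.trans ?_
    simp [map_ofNat]
  have he1 : bf Real.goldenConj (jc ∘ ev 5) (jc ∘ ev 5) = 2 := by
    have := evj_self jc 5; rwa [jc_ph] at this
  have hf1 : bf Real.goldenConj (jc ∘ f) (jc ∘ f) = 2 := by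
    have := aj_form jc w (jc ∘ ev 5) (jc ∘ ev 5)
    rwa [jc_ph, hc, he1] at this
  have hs1 := bc_nonneg (jc ∘ ev 5 - jc ∘ f)
  have hs2 := bc_nonneg (jc ∘ ev 5 + jc ∘ f)
  rw [bf_sub, he1, hf1, hkc] at hs1
  rw [bf_add, he1, hf1, hkc] at hs2
  rw [hkr, abs_lt] at hlt
  have hy0 : y = 0 := by
    have a1 := jr_apply y
    have a2 := jc_apply y
    have a3 := Real.goldenRatio_sub_goldenConj
    have a4 : (2 : ℝ) ≤ √5 := by
      rw [Real.le_sqrt] <;> norm_num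
    have a5 : jr y - jc y = y.im * √5 := by rw [a1, a2, ← a3]; ring
    have him : y.im = 0 := by
      by_contra hne
      rcases lt_or_gt_of_ne hne with h | h
      · have : (y.im : ℝ) ≤ -1 := by exact_mod_cast (by omega : y.im ≤ -1)
        nlinarith
      · have : (1 : ℝ) ≤ y.im := by exact_mod_cast (by omega : 1 ≤ y.im)
        nlinarith
    rw [him] at a1
    have hre : y.re = 0 := by
      by_contra hne
      rcases lt_or_gt_of_ne hne with h | h
      · have : (y.re : ℝ) ≤ -1 := by exact_mod_cast (by omega : y.re ≤ -1)
        simp at a1; linarith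
      · have : (1 : ℝ) ≤ y.re := by exact_mod_cast (by omega : 1 ≤ y.re)
        simp at a1; linarith
    ext
    · simpa using hre
    · simpa using him
  have hz : bf Real.goldenConj (jc ∘ ev 5 - jc ∘ f) (jc ∘ ev 5 - jc ∘ f) = 0 := by
    rw [bf_sub, he1, hf1, hkc, hy0]; simp; norm_num
  have hz := bc_zero _ hz
  have : f = ev 5 := by
    ext1 i
    have h := congrFun hz i
    simp only [Pi.sub_apply, Function.comp_apply, Pi.zero_apply] at h
    rw [← map_sub] at h
    exact (sub_eq_zero.1 (jc_inj _ h)).symm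
  rw [hr, this]; rfl

theorem rev_cs (a b : Fin 5 → ℝ) (ha : bb a a < 0) (hb : bb b b < 0) :
    bb a a * bb b b ≤ bb a b ^ 2 := by
  by_contra h
  push Not at h
  have hp := Real.goldenRatio_pos
  have key : 0 ≤ (b 3)^2 * bb a a - 2 * (a 3 * b 3) * bb a b + (a 3)^2 * bb b b := by
    have : (b 3)^2 * bb a a - 2 * (a 3 * b 3) * bb a b + (a 3)^2 * bb b b =
      (b 3 * a 0 - a 3 * b 0)^2 + (b 3 * a 1 - a 3 * b 1)^2 + (b 3 * a 2 - a 3 * b 2)^2 +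
        2 * (b 3 * a 4 - a 3 * b 4)^2 := by
      unfold bb bf; ring
    rw [this]; positivity
  have ha3 : a 3 ≠ 0 := by
    intro h0
    have : 0 ≤ bb a a := by
      unfold bb bf; rw [h0]
      nlinarith [mul_self_nonneg (a 0), mul_self_nonneg (a 1), mul_self_nonneg (a 2), mul_self_nonneg (a 4)]
    linarith
  have h1 : 0 < (bb a a * bb b b - bb a b ^ 2) * (a 3)^2 := by
    apply mul_pos (by linarith); positivity
  have h2 := mul_nonpos_of_nonpos_of_nonneg ha.le key
  have h3 := sq_nonneg (bb a a * b 3 - bb a b * a 3)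
  nlinarith

/-- the fifth basis vector -/
def uu : Fin 5 → ℝ := Pi.single 4 1

theorem bb_uu (x) : bb x uu = 2 * x 4 := by simp [bb, bf, uu]

theorem ar_uu (w) : ar w uu = uu := aj_e4 jr w

theorem ping (w : WW) (hw : w ∈ ps.ker) (hne : ar w (er 5) ≠ er 5) (x) (hx : bb x x < 0)
    (hle : |bb x (er 5)| ≤ |bb x uu|) : |bb (ar w x) uu| < |bb (ar w x) (er 5)| := by
  have hz : bb (ar w x) uu = bb x uu := by
    rw [← ar_form w x uu, ar_uu]
  set f := ar w⁻¹ (er 5) with hf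
  have hwf : ar w f = er 5 := aj_inv' jr w (er 5)
  have hp' : bb (ar w x) (er 5) = bb x f := by
    rw [← ar_form w x f, hwf]
  have hfne : f ≠ er 5 := by
    intro h; rw [h] at hwf; exact hne hwf
  have hK := K_large w⁻¹ (Subgroup.inv_mem _ hw) hfne
  rw [← hf] at hK
  have hff : bb f f = 2 := by rw [hf, ar_form, er_self]
  have hf4 : f 4 = 0 := by
    have h1 := bb_uu f
    rw [← ar_form w f uu, hwf, ar_uu, bb_uu, er4] at h1
    linarith
  obtain ⟨ε, hε, hεK⟩ : ∃ ε : ℝ, (ε = 1 ∨ ε = -1) ∧ ε * bb (er 5) f ≤ -6 := by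
    rcases le_abs.1 hK with h | h
    · exact ⟨-1, Or.inr rfl, by linarith⟩
    · exact ⟨1, Or.inl rfl, by linarith⟩
  have hε2 : ε ^ 2 = 1 := by rcases hε with rfl | rfl <;> norm_num
  set v := er 5 + ε • f with hv
  have hvv : bb v v ≤ -8 := by
    have : bb v v = bb (er 5) (er 5) + ε^2 * bb f f + 2 * (ε * bb (er 5) f) := by
      rw [hv]; unfold bb bf; simp only [Pi.add_apply, Pi.smul_apply, smul_eq_mul]; ring
    rw [this, er_self, hff, hε2]; linarith
  have hv4 : v 4 = 0 := by simp [hv, er4, hf4]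
  set xh := x - x 4 • uu with hxh
  have hxx : bb xh xh = bb x x - 2 * (x 4)^2 := by
    rw [hxh]; unfold bb bf uu; simp; ring
  have hxv : bb xh v = bb x (er 5) + ε * bb x f := by
    have : bb xh v = bb x v - 2 * x 4 * v 4 := by
      rw [hxh]; unfold bb bf uu; simp; ring
    rw [this, hv4, hv]; unfold bb bf; simp only [Pi.add_apply, Pi.smul_apply, smul_eq_mul]; ring
  have hcs := rev_cs xh v (by rw [hxx]; nlinarith [sq_nonneg (x 4)]) (by linarith)
  have hsq : (2 * bb x uu)^2 < (bb x (er 5) + ε * bb x f)^2 := by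
    rw [← hxv, bb_uu]
    rw [hxx] at hcs
    nlinarith [sq_nonneg (x 4)]
  have habs := sq_lt_sq.1 hsq
  have h1 : |bb x (er 5) + ε * bb x f| ≤ |bb x (er 5)| + |bb x f| := by
    refine (abs_add_le _ _).trans ?_
    rcases hε with rfl | rfl <;> simp
  rw [abs_mul, abs_two] at habs
  rw [hz, hp']
  linarith

/-- root of the swap -/
def dI : Fin 5 → RR := ev 5 - Pi.single 4 1

/-- twice the swap -/
def rI : Matrix (Fin 5) (Fin 5) RR :=
  Matrix.of fun i k => (if i = k then 2 else 0) - dI i * (gd ph k * dI k)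

theorem rI_sq : rI * rI = (4 : RR) • (1 : Matrix (Fin 5) (Fin 5) RR) := by decide +kernel

theorem rI_mulVec (x : Fin 5 → ℝ) : rI.map jr *ᵥ x = (2 : ℝ) • x - bb x (er 5 - uu) • (er 5 - uu) := by
  have hd : ∀ i, jr (dI i) = (er 5 - uu) i := by
    intro i; simp only [dI, Pi.sub_apply, map_sub, er, uu, Function.comp_apply]
    congr 1
    fin_cases i <;> simp
  have hg : ∀ k, jr (gd ph k) = gd Real.goldenRatio k := by
    intro k; fin_cases k <;> simp [gd, jr_ph, j_two]
  ext i
  simp only [Matrix.mulVec, dotProduct, Matrix.map_apply, rI, Matrix.of_apply, map_sub, map_mul, hd, hg, apply_ite jr, j_two, map_zero]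
  generalize er 5 - uu = d
  simp only [sub_mul, Finset.sum_sub_distrib, ite_mul, zero_mul, Finset.sum_ite_eq, Finset.mem_univ, if_true]
  simp only [Pi.sub_apply, Pi.smul_apply, smul_eq_mul, bb, bf, Fin.sum_univ_five, gd]
  simp
  ring

/-- the swap -/
noncomputable def rg : GL (Fin 5) ℝ :=
  have h : ((1/2 : ℝ) • rI.map jr) * ((1/2 : ℝ) • rI.map jr) = 1 := by
    rw [smul_mul_smul_comm, ← Matrix.map_mul, rI_sq]
    ext i k
    have : jr 4 = 4 := map_ofNat jr 4
    by_cases hik : i = k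
    · subst hik; simp [Matrix.map_apply, this]; norm_num
    · simp [Matrix.map_apply, hik]
  ⟨(1/2 : ℝ) • rI.map jr, (1/2 : ℝ) • rI.map jr, h, h⟩

theorem rg_val : (rg : Matrix (Fin 5) (Fin 5) ℝ) = (1/2 : ℝ) • rI.map jr := rfl

theorem rg_sq : rg * rg = 1 := by
  apply Units.ext
  exact rg.val_inv

theorem rg_mulVec (x : Fin 5 → ℝ) : rg.val *ᵥ x = x - (bb x (er 5 - uu) / 2) • (er 5 - uu) := by
  rw [rg_val, smul_mulVec, rI_mulVec, smul_sub, smul_smul, smul_smul]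
  congr 1
  · norm_num
  · congr 1; ring

theorem bb_e5u : bb (er 5) uu = 0 := by rw [bb_uu, er4]; simp
theorem bb_uuu : bb uu uu = 2 := by rw [bb_uu]; simp [uu]
theorem bb_sub (x y z) : bb x (y - z) = bb x y - bb x z := by
  unfold bb bf; simp only [Pi.sub_apply]; ring

theorem bb_d : bb (er 5 - uu) (er 5 - uu) = 4 := by
  have := bf_sub Real.goldenRatio (er 5) uu
  have h1 := er_self 5
  have h2 := bb_e5u
  have h3 := bb_uuu
  unfold bb at *
  rw [this, h1, h2, h3]; norm_num

theorem rg_form (x y) : bb (rg.val *ᵥ x) (rg.val *ᵥ y) = bb x y := by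
  rw [rg_mulVec, rg_mulVec]
  have hd := bb_d
  generalize er 5 - uu = d at *
  have : bb (x - (bb x d / 2) • d) (y - (bb y d / 2) • d) =
      bb x y - bb x d * bb y d + bb x d * bb y d / 4 * bb d d := by
    unfold bb bf; simp only [Pi.sub_apply, Pi.smul_apply, smul_eq_mul]; ring
  rw [this, hd]; ring

theorem rg_e : rg.val *ᵥ er 5 = uu := by
  rw [rg_mulVec, bb_sub, er_self, bb_e5u]; simp
theorem rg_u : rg.val *ᵥ uu = er 5 := by
  rw [rg_mulVec, bb_sub, bb_comm, bb_e5u, bb_uuu]; simp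

theorem rg_be (x) : bb (rg.val *ᵥ x) (er 5) = bb x uu := by
  rw [← rg_u, rg_form]
theorem rg_bu (x) : bb (rg.val *ᵥ x) uu = bb x (er 5) := by
  rw [← rg_e, rg_form]

/-- real representation -/
noncomputable def rr : WW →* GL (Fin 5) ℝ := (Matrix.GeneralLinearGroup.map jr).comp rh

theorem rr_mulVec (w x) : (rr w).val *ᵥ x = ar w x := rfl

theorem rr_inj : Function.Injective rr := by
  rw [injective_iff_map_eq_one]
  intro w h
  apply rh_inj
  intro x
  rw [← rr_mulVec, h]; simp

theorem fg_of_map_inj {G H : Type*} [Group G] [Group H] (f : G →* H) (hf : Function.Injective f)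
    (K : Subgroup G) (h : (K.map f).FG) : K.FG := by
  rw [← Group.fg_iff_subgroup_fg] at h ⊢
  exact Group.fg_of_surjective (f := (K.equivMapOfInjective f hf).symm.toMonoidHom)
    (K.equivMapOfInjective f hf).symm.surjective

/-- stabilizer -/
noncomputable def Cst : Subgroup (GL (Fin 5) ℝ) where
  carrier := {g | g.val *ᵥ er 5 = er 5}
  one_mem' := by simp
  mul_mem' := by
    intro a b ha hb
    simp only [Set.mem_setOf_eq, Units.val_mul, ← mulVec_mulVec] at *
    rw [hb, ha]
  inv_mem' := by
    intro a ha
    simp only [Set.mem_setOf_eq] at *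
    conv_lhs => rw [← ha]
    rw [mulVec_mulVec, Units.inv_mul, one_mulVec]

theorem mem_Cst (g) : g ∈ Cst ↔ g.val *ᵥ er 5 = er 5 := Iff.rfl

theorem real_group : ∃ H : Subgroup (GL (Fin 5) ℝ), H.FG ∧ ¬ IsFinitelyPresented H ∧
      ∀ K : Subgroup (GL (Fin 5) ℝ), (∀ w ∈ ps.ker, rr w ∈ K) →
        (∀ w ∈ ps.ker, rg * rr w * rg ∈ K) → H ≤ K := by
  have hxu : bb xb uu = 0 := by
    rw [bb_uu]; simp [xb, er4]
  have hmem : ∀ n : NW.map rr, n ∉ Cst.subgroupOf (NW.map rr) →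
      ∃ w ∈ ps.ker, rr w = n ∧ ar w (er 5) ≠ er 5 := by
    rintro ⟨_, w, hw, rfl⟩ hn
    exact ⟨w, hw.2, rfl, fun h => hn h⟩
  have hpp : ∀ n : NW.map rr, n ∉ Cst.subgroupOf (NW.map rr) → ∀ x : Fin 5 → ℝ, bb x x < 0 →
      |bb x (er 5)| ≤ |bb x uu| → bb (n.1.val *ᵥ x) (n.1.val *ᵥ x) < 0 ∧
        |bb (n.1.val *ᵥ x) uu| < |bb (n.1.val *ᵥ x) (er 5)| := by
    intro n hn x hx hle
    obtain ⟨w, hw, h1, h2⟩ := hmem n hn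
    rw [← h1, rr_mulVec]
    exact ⟨by rwa [ar_form], ping w hw h2 x hx hle⟩
  obtain ⟨H, h1, h2, h3, h4⟩ := amalgam_not_fp (G := GL (Fin 5) ℝ) (X := Fin 5 → ℝ)
    (fun g x => g.val *ᵥ x) (fun g h x => by rw [Units.val_mul, mulVec_mulVec])
    (fun x => by simp) (NW.map rr) rg rg_sq (fg_map' _ NW_fg)
    (Cst.subgroupOf (NW.map rr)) (by
      rintro ⟨_, w, hw, rfl⟩ hc
      have hc : ar w (er 5) = er 5 := hc
      apply Units.ext
      apply mat_ext
      intro x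
      have hd : ar w (er 5 - uu) = er 5 - uu := by
        unfold ar; rw [aj_sub]; exact congrArg₂ _ hc (ar_uu w)
      show ((rg.val * (rr w).val * rg.val) *ᵥ x) = (rr w).val *ᵥ x
      rw [← mulVec_mulVec, ← mulVec_mulVec, rr_mulVec, rr_mulVec, rg_mulVec x]
      have e1 : ar w (x - (bb x (er 5 - uu) / 2) • (er 5 - uu)) =
          ar w x - (bb x (er 5 - uu) / 2) • (er 5 - uu) := by
        conv_rhs => rw [← hd]
        unfold ar
        rw [aj_sub, aj_smul]
        congr 3
        exact congrArg₂ _ rfl hd.symm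
      rw [e1, mulVec_sub, mulVec_smul, mulVec_sub, rg_e, rg_u, rg_mulVec]
      have e2 : bb (ar w x) (er 5 - uu) = bb x (er 5 - uu) := by
        rw [← ar_form w x, hd]
      rw [e2, ← neg_sub uu (er 5), smul_neg]
      abel) (by
      intro hfg
      have h1 := fg_map' (NW.map rr).subtype hfg
      apply C0_not_fg ps
      apply fg_of_map_inj rr rr_inj
      convert h1 using 1
      ext g
      simp only [Subgroup.mem_map]
      constructor
      · rintro ⟨w, ⟨⟨hw1, hw2⟩, hw3⟩, rfl⟩
        exact ⟨⟨rr w, w, ⟨hw2, hw3⟩, rfl⟩, Wp_fix w hw1, rfl⟩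
      · rintro ⟨⟨_, w, hw, rfl⟩, hc, rfl⟩
        exact ⟨w, ⟨⟨stab w hc, hw.1⟩, hw.2⟩, rfl⟩)
    {x | bb x x < 0 ∧ |bb x (er 5)| ≤ |bb x uu|} {x | bb x x < 0 ∧ |bb x uu| ≤ |bb x (er 5)|}
    xb ⟨Fu_xb.1, by rw [xb_5, hxu]⟩ ⟨Fu_xb.1, by rw [xb_5, hxu]⟩
    (by
      intro n hn x hx
      obtain ⟨a1, a2⟩ := hpp n hn x hx.1 hx.2
      exact ⟨⟨a1, a2.le⟩, fun h => absurd h.2 (not_le.2 a2)⟩)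
    (by
      intro n hn x hx
      obtain ⟨a1, a2⟩ := hpp n hn (rg.val *ᵥ x) (by rw [rg_form]; exact hx.1)
        (by rw [rg_be, rg_bu]; exact hx.2)
      have e : (rg * n.1 * rg).val *ᵥ x = rg.val *ᵥ (n.1.val *ᵥ (rg.val *ᵥ x)) := by
        simp only [Units.val_mul, mulVec_mulVec, Matrix.mul_assoc]
      show (_ ∧ _) ∧ ¬ (_ ∧ _)
      simp only [e, rg_form, rg_be, rg_bu]
      exact ⟨⟨a1, a2.le⟩, fun h => absurd h.2 (not_le.2 a2)⟩)
  refine ⟨H, h2, h3, fun K k1 k2 => h4 K ?_ ?_⟩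
  · rintro _ ⟨w, hw, rfl⟩; exact k1 w hw.2
  · rintro _ ⟨w, hw, rfl⟩; exact k2 w hw.2

end PingPong
end Paper

namespace Paper
section Embed
open Matrix

/-- change of basis -/
def TI : Matrix (Fin 5) (Fin 5) RR :=
  !![⟨1,1⟩, ⟨-1,1⟩, ⟨-1,-1⟩, ⟨-2,-3⟩, ⟨-2,-2⟩;
     0, 0, ⟨0,-2⟩, ⟨-2,-4⟩, ⟨0,-4⟩;
     ⟨1,-1⟩, ⟨1,1⟩, ⟨1,-1⟩, ⟨-2,-3⟩, ⟨0,-2⟩;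
     0, 0, 2, ⟨-2,-2⟩, 0;
     0, 0, 0, ⟨0,-2⟩, ⟨0,2⟩]

/-- doubled Gram matrix -/
def Q2 : Matrix (Fin 5) (Fin 5) RR :=
  !![2, -ph, 0, 0, 0;
     -ph, 2, -1, 0, 0;
     0, -1, 2, -1, 0;
     0, 0, -1, 2, -ph;
     0, 0, 0, -ph, 2]

/-- forty times the inverse -/
def TsI : Matrix (Fin 5) (Fin 5) RR :=
  Matrix.diagonal ![2, 2, 2, ⟨2,-2⟩, 1] * ((⟨3,-1⟩ : RR) • (TIᵀ * Q2))

theorem T_Ts : TI * TsI = (40 : RR) • (1 : Matrix (Fin 5) (Fin 5) RR) := by decide +kernel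
theorem Ts_T : TsI * TI = (40 : RR) • (1 : Matrix (Fin 5) (Fin 5) RR) := by decide +kernel
theorem T_Q : TIᵀ * Q2 * TI = (⟨8, 4⟩ : RR) • Matrix.diagonal (gd ph) := by decide +kernel

theorem jr_inj : Function.Injective jr := by
  rw [injective_iff_map_eq_zero]
  intro z h
  rw [jr_apply] at h
  have hi := Real.goldenRatio_irrational
  have him : z.im = 0 := by
    by_contra hne
    have := (hi.intCast_mul hne).intCast_add z.re
    rw [h] at this
    exact this.ne_zero rfl
  rw [him] at h
  ext
  · simpa using h
  · simpa using him

theorem map_smul_one (c : RR) : ((c • (1 : Matrix (Fin 5) (Fin 5) RR)).map jr) = (jr c) • 1 := by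
  ext i k
  by_cases hik : i = k
  · subst hik; simp
  · simp [hik]

theorem jr_40 : jr 40 = 40 := map_ofNat jr 40

/-- change of basis, real -/
noncomputable def TT : GL (Fin 5) ℝ :=
  ⟨TI.map jr, (1/40 : ℝ) • TsI.map jr, by
    rw [mul_smul_comm, ← Matrix.map_mul, T_Ts, map_smul_one, smul_smul, jr_40]; norm_num, by
    rw [smul_mul_assoc, ← Matrix.map_mul, Ts_T, map_smul_one, smul_smul, jr_40]; norm_num⟩

theorem TT_val : TT.val = TI.map jr := rfl
theorem TT_inv : (TT⁻¹).val = (1/40 : ℝ) • TsI.map jr := rfl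

/-- golden ratio in A -/
noncomputable def pA : Asqrt5 := ⟨(1 + sqrt5) / 2, by
  refine ⟨Polynomial.X ^ 2 - Polynomial.X - 1, ?_, ?_⟩
  · have : (Polynomial.X ^ 2 - Polynomial.X - 1 : Polynomial ℤ) =
      Polynomial.X ^ 2 - (Polynomial.X + 1) := by ring
    rw [this]
    apply Polynomial.monic_X_pow_sub
    have h1 : (Polynomial.X + 1 : Polynomial ℤ).degree = 1 := Polynomial.degree_X_add_C (R := ℤ) 1
    rw [h1]; norm_num
  · have h5 : sqrt5 * sqrt5 = 5 := by
      apply Subtype.ext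
      exact Real.mul_self_sqrt (by norm_num)
    simp
    field_simp
    linear_combination h5⟩

theorem pA_val : algebraMap Asqrt5 Ksqrt5 pA = (1 + sqrt5) / 2 := rfl

/-- embedding of A -/
noncomputable def ia : Asqrt5 →+* ℝ := (algebraMap Ksqrt5 ℝ).comp (algebraMap Asqrt5 Ksqrt5)

theorem ia_inj : Function.Injective ia :=
  (algebraMap Ksqrt5 ℝ).injective.comp NumberField.RingOfIntegers.coe_injective

theorem k_sqrt5 : algebraMap Ksqrt5 ℝ sqrt5 = √5 := rfl

theorem ia_pA : ia pA = Real.goldenRatio := by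
  unfold ia
  rw [RingHom.comp_apply, pA_val, map_div₀, map_add, k_sqrt5, map_one, map_ofNat]

/-- hom into A -/
noncomputable def js : RR →+* Asqrt5 := (QuadraticAlgebra.lift ⟨pA, by
  apply ia_inj
  simp [ia_pA]; linarith [Real.goldenRatio_sq, sq Real.goldenRatio]⟩ : RR →ₐ[ℤ] Asqrt5).toRingHom

theorem ia_js (z : RR) : ia (js z) = jr z := by
  rw [jr_apply]
  simp [js, QuadraticAlgebra.lift, ia_pA]

variable {m n : ℕ}

/-- block embedding -/
def blk (e : Fin 5 ⊕ Fin m ≃ Fin (n + 1)) (S : Type*) [CommRing S] :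
    Matrix (Fin 5) (Fin 5) S →* Matrix (Fin (n+1)) (Fin (n+1)) S where
  toFun M := (Matrix.fromBlocks M 0 0 1).submatrix e.symm e.symm
  map_one' := by simp [Matrix.fromBlocks_one]
  map_mul' A B := by
    rw [Matrix.submatrix_mul_equiv, Matrix.fromBlocks_multiply]; simp

theorem blk_map (e : Fin 5 ⊕ Fin m ≃ Fin (n + 1)) {S T : Type*} [CommRing S] [CommRing T] (f : S →+* T)
    (M : Matrix (Fin 5) (Fin 5) S) : (blk e S M).map f = blk e T (M.map f) := by
  unfold blk
  ext i k
  simp only [MonoidHom.coe_mk, OneHom.coe_mk, Matrix.map_apply, Matrix.submatrix_apply]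
  rcases e.symm i with i | i <;> rcases e.symm k with k | k <;> simp [Matrix.one_apply, apply_ite f]

theorem blk_inj (e : Fin 5 ⊕ Fin m ≃ Fin (n + 1)) {S : Type*} [CommRing S] :
    Function.Injective (blk e S) := by
  intro A B h
  ext i k
  have := congrFun (congrFun h (e (Sum.inl i))) (e (Sum.inl k))
  simpa [blk] using this

/-- the real embedding -/
noncomputable def JJ (e : Fin 5 ⊕ Fin m ≃ Fin (n + 1)) : GL (Fin 5) ℝ →* GL (Fin (n+1)) ℝ :=
  (Units.map (blk e ℝ)).comp (MulAut.conj TT).toMonoidHom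

theorem JJ_val (e : Fin 5 ⊕ Fin m ≃ Fin (n + 1)) (g) :
    (JJ e g).val = blk e ℝ (TT.val * g.val * (TT⁻¹).val) := rfl

theorem JJ_inj (e : Fin 5 ⊕ Fin m ≃ Fin (n + 1)) : Function.Injective (JJ e) := by
  unfold JJ
  exact (Units.map_injective (blk_inj e)).comp (MulAut.conj TT).injective

/-- ortho group into real group -/
noncomputable def II (n a : ℕ) : orthoGram Asqrt5 (fA n a) →* GL (Fin (n+1)) ℝ :=
  (Matrix.GeneralLinearGroup.map ia).comp (Subgroup.subtype _)

theorem II_inj (n a : ℕ) : Function.Injective (II n a) := by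
  have h : Function.Injective (Matrix.GeneralLinearGroup.map (n := Fin (n+1)) ia) := Units.map_injective (f := (ia.mapMatrix : Matrix (Fin (n+1)) (Fin (n+1)) Asqrt5 →+* _).toMonoidHom)
    (Matrix.map_injective ia_inj)
  exact fun x y hxy => Subtype.ext (h hxy)

theorem Q120_map : Q120.map (algebraMap Ksqrt5 ℝ) = (1/2 : ℝ) • Q2.map jr := by
  have h : algebraMap Ksqrt5 ℝ (-(1 + sqrt5)/4) = - (Real.goldenRatio / 2) := by
    rw [map_div₀, map_neg, map_add, k_sqrt5, map_one, map_ofNat]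
    unfold Real.goldenRatio; ring
  have h2 : jr 2 = 2 := j_two jr
  have h3 : algebraMap Ksqrt5 ℝ (-(1/2)) = - (1 / 2) := by
    rw [map_neg, map_div₀, map_one, map_ofNat]
  unfold Q120
  generalize -(1 + sqrt5)/4 = c at *
  generalize -(1/2 : Ksqrt5) = d at *
  generalize algebraMap Ksqrt5 ℝ = f at *
  refine Matrix.ext fun i k => ?_
  fin_cases i <;> fin_cases k <;> simp [Q2, h, jr_ph, h2, h3] <;> ring

theorem form_gram (g : Matrix (Fin 5) (Fin 5) ℝ) (hg : ∀ x y, bb (g *ᵥ x) (g *ᵥ y) = bb x y) :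
    gᵀ * Matrix.diagonal (gd Real.goldenRatio) * g = Matrix.diagonal (gd Real.goldenRatio) := by
  have hb : ∀ x y, bb x y = x ⬝ᵥ (Matrix.diagonal (gd Real.goldenRatio) *ᵥ y) := by
    intro x y
    simp [bb, bf, dotProduct, Fin.sum_univ_five, Matrix.mulVec_diagonal, gd]; ring
  refine Matrix.ext fun i k => ?_
  have h := hg (Pi.single i 1) (Pi.single k 1)
  rw [hb, hb] at h
  have h2 : ∀ A : Matrix (Fin 5) (Fin 5) ℝ, A i k = (Pi.single i 1) ⬝ᵥ (A *ᵥ (Pi.single k 1)) := by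
    intro A; simp
  rw [h2 (gᵀ * _ * g), h2 (Matrix.diagonal _), ← h]
  rw [← mulVec_mulVec, ← mulVec_mulVec, dotProduct_mulVec, ← mulVec_transpose, transpose_transpose]

theorem fA_blk (e : Fin 5 ⊕ Fin m ≃ Fin (n + 1)) (h1 : ∀ i, (e (Sum.inl i) : ℕ) = i)
    (h2 : ∀ i, (e (Sum.inr i) : ℕ) = 5 + i) (a : ℕ) :
    fA n a = (Matrix.fromBlocks Q120 0 0
      (Matrix.diagonal (fun i : Fin m => if (i : ℕ) = 0 then (a : Ksqrt5) else 1))).submatrix e.symm e.symm := by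
  have : (fA n a).submatrix e e = (Matrix.fromBlocks Q120 0 0
      (Matrix.diagonal (fun i : Fin m => if (i : ℕ) = 0 then (a : Ksqrt5) else 1))) := by
    ext i k
    rcases i with i | i <;> rcases k with k | k
    · simp [fA, h1]
    · simp [fA, h1, h2]; intro; omega
    · simp [fA, h1, h2]; intro; omega
    · by_cases hik : i = k
      · subst hik; simp [fA, h2]
      · have : (i : ℕ) ≠ k := fun h => hik (Fin.ext h)
        simp [fA, h2, hik, this]
  rw [← this]; simp

theorem mem_range (e : Fin 5 ⊕ Fin m ≃ Fin (n + 1)) (h1 : ∀ i, (e (Sum.inl i) : ℕ) = i)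
    (h2 : ∀ i, (e (Sum.inr i) : ℕ) = 5 + i) (a : ℕ) (g : GL (Fin 5) ℝ)
    (hg : ∀ x y, bb (g.val *ᵥ x) (g.val *ᵥ y) = bb x y) (Y Y' : Matrix (Fin 5) (Fin 5) RR)
    (hY : TT.val * g.val * (TT⁻¹).val = Y.map jr) (hY' : TT.val * (g⁻¹).val * (TT⁻¹).val = Y'.map jr) :
    JJ e g ∈ (II n a).range := by
  have e1 : (TT * g * TT⁻¹).val = Y.map jr := hY
  have e2 : ((TT * g * TT⁻¹)⁻¹).val = Y'.map jr := by
    rw [← hY']; simp [mul_assoc]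
  have hm := Matrix.map_injective (m := Fin 5) (n := Fin 5) jr_inj
  have hYY : Y * Y' = 1 := by
    apply hm
    simp only
    rw [Matrix.map_mul, ← e1, ← e2, Units.mul_inv, Matrix.map_one _ (map_zero _) (map_one _)]
  have hYY' : Y' * Y = 1 := by
    apply hm
    simp only
    rw [Matrix.map_mul, ← e1, ← e2, Units.inv_mul, Matrix.map_one _ (map_zero _) (map_one _)]
  let y : GL (Fin 5) RR := ⟨Y, Y', hYY, hYY'⟩
  let z : GL (Fin (n+1)) Asqrt5 := Units.map (blk e Asqrt5) (Matrix.GeneralLinearGroup.map js y)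
  have hz : z.val = blk e Asqrt5 (Y.map js) := rfl
  have hzr : z.val.map ia = blk e ℝ (Y.map jr) := by
    rw [hz, blk_map]
    exact congrArg (blk e ℝ) (Matrix.ext fun i k => ia_js _)
  have hG := form_gram _ hg
  have hQT : TT.valᵀ * (Q120.map (algebraMap Ksqrt5 ℝ)) * TT.val =
      (jr ⟨8,4⟩ / 2) • Matrix.diagonal (gd Real.goldenRatio) := by
    have := congrArg (fun M : Matrix (Fin 5) (Fin 5) RR => M.map jr) T_Q
    simp only [Matrix.map_mul] at this
    rw [Q120_map, TT_val, mul_smul_comm, smul_mul_assoc, ← Matrix.transpose_map, this]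
    ext i k
    have hg : ∀ k, jr (gd ph k) = gd Real.goldenRatio k := by
      intro k; fin_cases k <;> simp [gd, jr_ph, j_two]
    by_cases hik : i = k
    · subst hik; simp [hg]; ring
    · simp [hik]
  have hQ : (Y.map jr)ᵀ * (Q120.map (algebraMap Ksqrt5 ℝ)) * (Y.map jr) = Q120.map (algebraMap Ksqrt5 ℝ) := by
    rw [← hY]
    set Q := Q120.map (algebraMap Ksqrt5 ℝ)
    set T := TT.val
    set T' := (TT⁻¹).val
    have hTT : T * T' = 1 := TT.mul_inv
    have hTT2 : T'ᵀ * Tᵀ = 1 := by rw [← Matrix.transpose_mul, hTT, Matrix.transpose_one]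
    calc (T * g.val * T')ᵀ * Q * (T * g.val * T') = T'ᵀ * (g.valᵀ * (Tᵀ * Q * T) * g.val) * T' := by
          simp only [Matrix.transpose_mul, Matrix.mul_assoc]
      _ = T'ᵀ * (Tᵀ * Q * T) * T' := by
          rw [hQT, mul_smul_comm, smul_mul_assoc, hG]
      _ = (T'ᵀ * Tᵀ) * Q * (T * T') := by simp only [Matrix.mul_assoc]
      _ = Q := by rw [hTT, hTT2, one_mul, mul_one]
  have hmem : z ∈ orthoGram Asqrt5 (fA n a) := by
    show (z.val.map (algebraMap Asqrt5 Ksqrt5))ᵀ * fA n a * (z.val.map (algebraMap Asqrt5 Ksqrt5)) = fA n a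
    apply Matrix.map_injective (algebraMap Ksqrt5 ℝ).injective
    have hM : (z.val.map (algebraMap Asqrt5 Ksqrt5)).map (algebraMap Ksqrt5 ℝ) = blk e ℝ (Y.map jr) := hzr
    generalize z.val.map (algebraMap Asqrt5 Ksqrt5) = M at *
    simp only
    rw [Matrix.map_mul, Matrix.map_mul, Matrix.transpose_map, hM, fA_blk e h1 h2, ← Matrix.submatrix_map,
      Matrix.fromBlocks_map]
    unfold blk
    simp only [MonoidHom.coe_mk, OneHom.coe_mk, Matrix.transpose_submatrix, Matrix.submatrix_mul_equiv,
      Matrix.fromBlocks_transpose, Matrix.fromBlocks_multiply]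
    congr 1
    have h0 : ∀ p q : ℕ, (0 : Matrix (Fin p) (Fin q) Ksqrt5).map (algebraMap Ksqrt5 ℝ) = 0 :=
      fun p q => Matrix.map_zero _ (map_zero _)
    simp [hQ, h0]
  refine ⟨⟨z, hmem⟩, ?_⟩
  apply Units.ext
  rw [JJ_val, hY]
  exact hzr

theorem fp_iso {G H : Type*} [Group G] [Group H] (e : G ≃* H) (h : IsFinitelyPresented G) :
    IsFinitelyPresented H := by
  obtain ⟨k, rels, h1, ⟨f⟩⟩ := h
  exact ⟨k, rels, h1, ⟨f.trans e⟩⟩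

theorem conj1 (Z : Matrix (Fin 5) (Fin 5) RR) :
    TT.val * ((1 + (160 : RR) • Z).map jr) * (TT⁻¹).val = (1 + (4 : RR) • (TI * Z * TsI)).map jr := by
  have h : TI * (1 + (160 : RR) • Z) * TsI = (40 : RR) • (1 + (4 : RR) • (TI * Z * TsI)) := by
    rw [mul_add, add_mul, mul_one, T_Ts, mul_smul_comm, smul_mul_assoc, smul_add, smul_smul]
    norm_num
  rw [TT_val, TT_inv, mul_smul_comm, ← Matrix.map_mul, ← Matrix.map_mul, h]
  ext i k
  simp only [Matrix.smul_apply, Matrix.map_apply, smul_eq_mul, map_mul, jr_40]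
  ring

theorem conj2 (Z : Matrix (Fin 5) (Fin 5) RR) :
    TT.val * (rg.val * ((1 + (160 : RR) • Z).map jr) * rg.val) * (TT⁻¹).val =
      (1 + (TI * (rI * Z * rI) * TsI)).map jr := by
  have h : TI * (rI * (1 + (160 : RR) • Z) * rI) * TsI = (160 : RR) • (1 + (TI * (rI * Z * rI) * TsI)) := by
    rw [mul_add rI, add_mul, mul_one, rI_sq, mul_add, add_mul, mul_smul_comm, smul_mul_assoc, mul_one, T_Ts,
      smul_smul, mul_smul_comm, smul_mul_assoc, mul_smul_comm, smul_mul_assoc, smul_add]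
    norm_num
  rw [TT_val, TT_inv, rg_val]
  simp only [mul_smul_comm, smul_mul_assoc, smul_smul]
  simp only [← Matrix.map_mul]
  rw [h]
  have h160 : jr 160 = 160 := map_ofNat jr 160
  ext i k
  simp only [Matrix.smul_apply, Matrix.map_apply, smul_eq_mul, map_mul, h160]
  ring

end Embed

/-- For `n ≥ 5` and a positive integer `a`, the group `O(f_a, A)` over the
ring of integers `A` of `ℚ(√5)` is noncoherent. -/
theorem O_fA_noncoherent (n : ℕ) (hn : 5 ≤ n) (a : ℕ) (ha : 0 < a) :
    ∃ H : Subgroup ↥(orthoGram Asqrt5 (fA n a)), Group.FG ↥H ∧ ¬ IsFinitelyPresented ↥H := by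
  obtain ⟨H, hfg, hfp, hK⟩ := real_group
  obtain ⟨m, hm⟩ : ∃ m, 5 + m = n + 1 := ⟨n - 4, by omega⟩
  let e : Fin 5 ⊕ Fin m ≃ Fin (n + 1) := finSumFinEquiv.trans (finCongr hm)
  have h1 : ∀ i, (e (Sum.inl i) : ℕ) = i := fun i => by simp [e]
  have h2 : ∀ i, (e (Sum.inr i) : ℕ) = 5 + i := fun i => by simp [e]
  have hle : H ≤ (II n a).range.comap (JJ e) := by
    apply hK
    · intro w hw
      obtain ⟨Z, hZ⟩ := ps_ker w hw
      obtain ⟨Z', hZ'⟩ := ps_ker w⁻¹ (Subgroup.inv_mem _ hw)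
      refine mem_range e h1 h2 a _ (fun x y => ar_form w x y) _ (1 + (4 : RR) • (TI * Z' * TsI))
        ((congrArg (fun M : Matrix (Fin 5) (Fin 5) RR => TT.val * M.map jr * (TT⁻¹).val) hZ).trans (conj1 Z)) ?_
      rw [← map_inv]
      exact ((congrArg (fun M : Matrix (Fin 5) (Fin 5) RR => TT.val * M.map jr * (TT⁻¹).val) hZ').trans (conj1 Z'))
    · intro w hw
      obtain ⟨Z, hZ⟩ := ps_ker w hw
      obtain ⟨Z', hZ'⟩ := ps_ker w⁻¹ (Subgroup.inv_mem _ hw)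
      have hri : rg⁻¹ = rg := inv_eq_of_mul_eq_one_left rg_sq
      refine mem_range e h1 h2 a _ (fun x y => ?_) _ (1 + (TI * (rI * Z' * rI) * TsI))
        ((congrArg (fun M : Matrix (Fin 5) (Fin 5) RR =>
          TT.val * (rg.val * M.map jr * rg.val) * (TT⁻¹).val) hZ).trans (conj2 Z)) ?_
      · simp only [Units.val_mul, ← Matrix.mulVec_mulVec, rg_form, rr_mulVec, ar_form]
      · rw [mul_inv_rev, mul_inv_rev, hri, ← map_inv, ← mul_assoc]
        exact ((congrArg (fun M : Matrix (Fin 5) (Fin 5) RR =>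
          TT.val * (rg.val * M.map jr * rg.val) * (TT⁻¹).val) hZ').trans (conj2 Z'))
  have hr : H.map (JJ e) ≤ (II n a).range := Subgroup.map_le_iff_le_comap.2 hle
  have hmap : ((H.map (JJ e)).comap (II n a)).map (II n a) = H.map (JJ e) :=
    Subgroup.map_comap_eq_self hr
  refine ⟨(H.map (JJ e)).comap (II n a), ?_, ?_⟩
  · rw [Group.fg_iff_subgroup_fg]
    apply fg_of_map_inj _ (II_inj n a)
    rw [hmap]
    exact fg_map' _ hfg
  · intro h
    apply hfp
    have h3 := fp_iso (((H.map (JJ e)).comap (II n a)).equivMapOfInjective _ (II_inj n a)) h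
    rw [hmap] at h3
    exact fp_iso (H.equivMapOfInjective _ (JJ_inj e)).symm h3

end Paper
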